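/- Let d ≥ 3 and v : ℝ^d → ℝ be bounded, measurable, with bounded support, and let α₀ > 0 satisfy sup_x E[exp(α ∫₀^∞ |v(W_x(s))| ds)] < ∞ for |α| < α₀. Suppose x(t) → x and y(t) → y in ℝ^d. Let Z(t) be the path integral of v along the Brownian bridge from x(t) to y(t) over time t. Then for every α ∈ (−α₀, α₀), E[e^{α Z(t)}] → E[e^{α Y_x}] · E[e^{α Y_y}] as t → ∞, where Y_x = ∫₀^∞ v(W_x(s))ds, Y_y = ∫₀^∞ v(W_y(s))ds. -/

import Mathlib

open MeasureTheory Real Filter Topology ProbabilityTheory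

noncomputable section

/-- Euclidean space `ℝ^d`. -/
abbrev Euc (d : ℕ) := EuclideanSpace ℝ (Fin d)

/-- The Brownian transition density `q(s; w) = (2πs)^{-d/2} exp(-|w|²/(2s))`. -/
def heatKernel (d : ℕ) (s : ℝ) (w : Euc d) : ℝ :=
  (2 * π * s) ^ (-(d : ℝ) / 2) * Real.exp (-‖w‖ ^ 2 / (2 * s))

/-- Joint density of a Brownian motion started at `x`, at times `s 0 < s 1 < ⋯`. -/
def jointDensity (d : ℕ) {k : ℕ} (x : Euc d) (s : Fin k → ℝ) (z : Fin k → Euc d) : ℝ :=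
  ∏ j : Fin k,
    heatKernel d (s j - if (j : ℕ) = 0 then 0 else s ⟨(j : ℕ) - 1, lt_of_le_of_lt (Nat.sub_le _ _) j.isLt⟩)
      (z j - if (j : ℕ) = 0 then x else z ⟨(j : ℕ) - 1, lt_of_le_of_lt (Nat.sub_le _ _) j.isLt⟩)

/-- Joint density of the Brownian bridge from `a` to `b` in time `t`, at interior times `s`. -/
def bridgeDensity (d : ℕ) {k : ℕ} (t : ℝ) (a b : Euc d) (s : Fin k → ℝ) (z : Fin k → Euc d) : ℝ :=
  jointDensity d a (Fin.snoc s t) (Fin.snoc z b) / heatKernel d t (b - a)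

/-- The open ordered simplex `0 < s₁ < ⋯ < s_k < t`. -/
def simplex (k : ℕ) (t : ℝ) : Set (Fin k → ℝ) :=
  {s | StrictMono s ∧ ∀ i, 0 < s i ∧ s i < t}

/-- `W` is a standard `d`-dimensional Brownian motion started at `x`, characterized by
continuous paths and finite-dimensional densities given by products of heat kernels. -/
def IsBrownianMotion {Ω : Type*} [MeasureSpace Ω] {d : ℕ} (x : Euc d)
    (W : ℝ → Ω → Euc d) : Prop :=
  (∀ ω, W 0 ω = x) ∧ (∀ ω, Continuous fun s => W s ω) ∧
  ∀ (k : ℕ) (s : Fin (k + 1) → ℝ), StrictMono s → (∀ i, 0 < s i) →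
    Measure.map (fun ω (i : Fin (k + 1)) => W (s i) ω) (ℙ : Measure Ω) =
      (volume : Measure (Fin (k + 1) → Euc d)).withDensity
        (fun z => ENNReal.ofReal (jointDensity d x s z))

/-- `X` is a `d`-dimensional Brownian bridge from `a` to `b` in time `t`. -/
def IsBrownianBridge {Ω : Type*} [MeasureSpace Ω] {d : ℕ} (t : ℝ) (a b : Euc d)
    (X : ℝ → Ω → Euc d) : Prop :=
  (∀ ω, X 0 ω = a) ∧ (∀ ω, X t ω = b) ∧
  (∀ ω, ContinuousOn (fun s => X s ω) (Set.Icc 0 t)) ∧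
  ∀ (k : ℕ) (s : Fin (k + 1) → ℝ), StrictMono s → (∀ i, 0 < s i ∧ s i < t) →
    Measure.map (fun ω (i : Fin (k + 1)) => X (s i) ω) (ℙ : Measure Ω) =
      (volume : Measure (Fin (k + 1) → Euc d)).withDensity
        (fun z => ENNReal.ofReal (bridgeDensity d t a b s z))

/-- The path integral `∫₀^t v(X_s) ds`. -/
def pathInt {Ω : Type*} {d : ℕ} (v : Euc d → ℝ) (X : ℝ → Ω → Euc d) (t : ℝ) (ω : Ω) : ℝ :=
  ∫ s in Set.Ioc (0 : ℝ) t, v (X s ω)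

/-- The total path integral `∫₀^∞ v(X_s) ds`. -/
def pathIntInf {Ω : Type*} {d : ℕ} (v : Euc d → ℝ) (X : ℝ → Ω → Euc d) (ω : Ω) : ℝ :=
  ∫ s in Set.Ioi (0 : ℝ), v (X s ω)

/-- The density ratio `Q_{j} = q(t; y - x)/q(Δ_j s; Δ_j z)` with the conventions
`s₀ = 0`, `s_{k+1} = t`, `z₀ = x`, `z_{k+1} = y`. -/
def Qratio (d : ℕ) {k : ℕ} (t : ℝ) (x y : Euc d) (s : Fin k → ℝ) (z : Fin k → Euc d)
    (j : Fin (k + 1)) : ℝ :=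
  heatKernel d t (y - x) /
    heatKernel d
      ((Fin.cons 0 (Fin.snoc s t) : Fin (k + 2) → ℝ) j.succ -
        (Fin.cons 0 (Fin.snoc s t) : Fin (k + 2) → ℝ) j.castSucc)
      ((Fin.cons x (Fin.snoc z y) : Fin (k + 2) → Euc d) j.succ -
        (Fin.cons x (Fin.snoc z y) : Fin (k + 2) → Euc d) j.castSucc)

section

/-- A rational approximation of `s`, converging to `s` as `n → ∞`. -/
def ratApprox (n : ℕ) (s : ℝ) : ℚ := ⌊((n : ℝ) + 1) * s⌋ / ((n : ℚ) + 1)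

/-- The path on `ℝ` obtained from its restriction to `ℚ` as a limit. -/
def pathExt {F : Type*} [TopologicalSpace F] [Nonempty F] (p : ℚ → F) (s : ℝ) : F :=
  limUnder atTop fun n => p (ratApprox n s)

lemma measurable_ratApprox (n : ℕ) : Measurable (ratApprox n) := by
  unfold ratApprox
  have h1 : Measurable fun s : ℝ => ⌊((n : ℝ) + 1) * s⌋ :=
    Int.measurable_floor.comp (measurable_const_mul _)
  exact (measurable_from_top (f := fun k : ℤ => (k : ℚ) / ((n : ℚ) + 1))).comp h1

lemma tendsto_ratApprox (s : ℝ) : Tendsto (fun n => (ratApprox n s : ℝ)) atTop (𝓝 s) := by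
  have h1 : Tendsto (fun n : ℕ => s - 1 / ((n : ℝ) + 1)) atTop (𝓝 s) := by
    simpa using tendsto_const_nhds.sub (tendsto_one_div_add_atTop_nhds_zero_nat (𝕜 := ℝ))
  refine tendsto_of_tendsto_of_tendsto_of_le_of_le h1 tendsto_const_nhds ?_ ?_
  · intro n
    have hn : (0 : ℝ) < (n : ℝ) + 1 := by positivity
    simp only [ratApprox]
    push_cast
    rw [le_div_iff₀ hn, sub_mul, one_div_mul_cancel hn.ne']
    linarith [Int.lt_floor_add_one (((n : ℝ) + 1) * s)]
  · intro n
    have hn : (0 : ℝ) < (n : ℝ) + 1 := by positivity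
    simp only [ratApprox]
    push_cast
    rw [div_le_iff₀ hn]
    linarith [Int.floor_le (((n : ℝ) + 1) * s)]

lemma pathExt_eq {F : Type*} [TopologicalSpace F] [T2Space F] [Nonempty F]
    {f : ℝ → F} (hf : Continuous f) (s : ℝ) : pathExt (fun q : ℚ => f q) s = f s :=
  ((hf.tendsto s).comp (tendsto_ratApprox s)).limUnder_eq

section
variable {F : Type*} [MetricSpace F] [CompleteSpace F] [SecondCountableTopology F] [Nonempty F]
  [MeasurableSpace F] [BorelSpace F]

lemma measurable_pathExt : Measurable fun z : (ℚ → F) × ℝ => pathExt z.1 z.2 := by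
  have h : ∀ n : ℕ, StronglyMeasurable fun z : (ℚ → F) × ℝ => z.1 (ratApprox n z.2) := by
    intro n
    have h1 : Measurable fun w : (ℚ → F) × ℚ => w.1 w.2 :=
      measurable_from_prod_countable_left fun q => measurable_pi_apply q
    exact (h1.comp (measurable_fst.prodMk
      ((measurable_ratApprox n).comp measurable_snd))).stronglyMeasurable
  exact (StronglyMeasurable.limUnder h).measurable

lemma exists_measurable_modification {Ω : Type*} [MeasurableSpace Ω] {μ : Measure Ω}
    {P : ℝ → Ω → F} (hc : ∀ ω, Continuous fun s => P s ω) (hm : ∀ s, AEMeasurable (P s) μ) :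
    ∃ P' : Ω × ℝ → F, Measurable P' ∧ ∀ᵐ ω ∂μ, ∀ s, P s ω = P' (ω, s) := by
  have hR : AEMeasurable (fun ω (q : ℚ) => P q ω) μ := aemeasurable_pi_iff.2 fun q => hm q
  refine ⟨fun z => pathExt (hR.mk _ z.1) z.2,
    measurable_pathExt.comp ((hR.measurable_mk.comp measurable_fst).prodMk measurable_snd), ?_⟩
  filter_upwards [hR.ae_eq_mk] with ω hω s
  rw [← hω, pathExt_eq (hc ω)]

end

section
variable {F : Type*} [MeasurableSpace F]

/-- Restriction of a path on `[0,1] ∩ ℚ` to the grid `{i / (m+1)}`. -/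
def gridRestrict (m : ℕ) (p : Set.Icc (0 : ℚ) 1 → F) (i : Fin (m + 2)) : F :=
  p ⟨(i : ℚ) / (m + 1), by positivity, by
    rw [div_le_one (by positivity)]
    exact_mod_cast Nat.lt_succ_iff.1 i.isLt⟩

lemma measurable_gridRestrict (m : ℕ) : Measurable (gridRestrict (F := F) m) :=
  measurable_pi_iff.2 fun _ => measurable_pi_apply _

lemma exists_grid_index (J : Finset (Set.Icc (0 : ℚ) 1)) :
    ∃ m : ℕ, ∀ u ∈ J, ∃ i : Fin (m + 2), (u : ℚ) = (i : ℚ) / (m + 1) := by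
  obtain ⟨m, hm⟩ : ∃ m : ℕ, m + 1 = ∏ u ∈ J, (u : ℚ).den :=
    ⟨_, Nat.sub_add_cancel (Nat.one_le_iff_ne_zero.2
      (Finset.prod_ne_zero_iff.2 fun u _ => (u : ℚ).den_nz))⟩
  refine ⟨m, fun u hu => ?_⟩
  obtain ⟨c, hc⟩ : (u : ℚ).den ∣ m + 1 := hm ▸ Finset.dvd_prod_of_mem _ hu
  have hd : ((u : ℚ).den : ℚ) ≠ 0 := by exact_mod_cast (u : ℚ).den_nz
  have hmq : ((m : ℚ) + 1) = (u : ℚ).den * c := by exact_mod_cast hc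
  have hm0 : ((m : ℚ) + 1) ≠ 0 := by positivity
  have hnum : 0 ≤ (u : ℚ).num := Rat.num_nonneg.2 u.2.1
  obtain ⟨k, hk⟩ := Int.eq_ofNat_of_zero_le hnum
  have hu' : (u : ℚ) = (k * c : ℕ) / ((m : ℚ) + 1) := by
    have hden := Rat.mul_den_eq_num (u : ℚ)
    rw [hk] at hden
    rw [eq_div_iff hm0, hmq, ← mul_assoc, hden]
    push_cast
    rfl
  have hle : (k * c : ℕ) ≤ m + 1 := by
    have := u.2.2
    rw [hu', div_le_one (by positivity)] at this
    exact_mod_cast this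
  exact ⟨⟨k * c, by omega⟩, hu'⟩

lemma measure_ext_of_grid {μ ν : Measure (Set.Icc (0 : ℚ) 1 → F)} [IsFiniteMeasure ν]
    (h : ∀ m, μ.map (gridRestrict m) = ν.map (gridRestrict m)) : μ = ν := by
  refine IsProjectiveLimit.unique (P := fun J => ν.map J.restrict) (fun J => ?_) fun J => rfl
  obtain ⟨m, hm⟩ := exists_grid_index J
  choose! i hi using hm
  have key : (J.restrict : (Set.Icc (0 : ℚ) 1 → F) → _) =
      (fun (g : Fin (m + 2) → F) (u : J) => g (i u)) ∘ gridRestrict m := by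
    funext p u
    simp only [Function.comp, gridRestrict, Finset.restrict]
    congr 1
    exact Subtype.ext (hi u u.2)
  have hmeas : Measurable (fun (g : Fin (m + 2) → F) (u : J) => g (i u)) :=
    measurable_pi_iff.2 fun _ => measurable_pi_apply _
  simp only [key]
  rw [← Measure.map_map hmeas (measurable_gridRestrict m),
    ← Measure.map_map hmeas (measurable_gridRestrict m), h m]

end

end

section

section
variable {d : ℕ}

lemma heatKernel_pos {s : ℝ} (hs : 0 < s) (w : Euc d) : 0 < heatKernel d s w := by
  unfold heatKernel; positivity

lemma heatKernel_sub_comm (s : ℝ) (w z : Euc d) :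
    heatKernel d s (w - z) = heatKernel d s (z - w) := by
  unfold heatKernel; rw [norm_sub_rev]

lemma continuous_heatKernel (s : ℝ) : Continuous (heatKernel d s) := by
  unfold heatKernel; fun_prop

@[fun_prop]
lemma measurable_heatKernel (s : ℝ) : Measurable (heatKernel d s) :=
  (continuous_heatKernel s).measurable

lemma heatKernel_le {s : ℝ} (hs : 0 < s) (w : Euc d) :
    heatKernel d s w ≤ (2 * π * s) ^ (-(d : ℝ) / 2) := by
  unfold heatKernel
  refine mul_le_of_le_one_right (by positivity) (Real.exp_le_one_iff.2 ?_)
  rw [neg_div]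
  exact neg_nonpos.2 (by positivity)

lemma jointDensity_eq_prod_range {k : ℕ} {x : Euc d} {σ : ℕ → ℝ} {ξ : ℕ → Euc d}
    (hσ : σ 0 = 0) (hξ : ξ 0 = x) {s : Fin k → ℝ} {z : Fin k → Euc d}
    (hs : ∀ i : Fin k, s i = σ (i + 1)) (hz : ∀ i : Fin k, z i = ξ (i + 1)) :
    jointDensity d x s z =
      ∏ i ∈ Finset.range k, heatKernel d (σ (i + 1) - σ i) (ξ (i + 1) - ξ i) := by
  unfold jointDensity
  rw [← Fin.prod_univ_eq_prod_range
    (fun i => heatKernel d (σ (i + 1) - σ i) (ξ (i + 1) - ξ i)) k]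
  refine Finset.prod_congr rfl fun j _ => ?_
  rcases Nat.eq_zero_or_pos (j : ℕ) with h | h
  · simp [h, hs, hz, hσ, hξ]
  · simp [h.ne', hs, hz, Nat.sub_add_cancel h]

lemma jointDensity_pos {k : ℕ} (x : Euc d) {s : Fin k → ℝ} (hs : StrictMono s)
    (hp : ∀ i, 0 < s i) (z : Fin k → Euc d) : 0 < jointDensity d x s z := by
  refine Finset.prod_pos fun j _ => heatKernel_pos ?_ _
  split_ifs with h
  · simpa using hp j
  · exact sub_pos.2 (hs (Fin.lt_def.2 (Nat.sub_lt (Nat.pos_of_ne_zero h) one_pos)))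

lemma measurable_jointDensity {k : ℕ} (x : Euc d) (s : Fin k → ℝ) :
    Measurable (jointDensity d x s) := by
  unfold jointDensity
  refine Finset.measurable_prod _ fun j _ => (measurable_heatKernel _).comp ?_
  refine (measurable_pi_apply j).sub ?_
  split_ifs
  · exact measurable_const
  · exact measurable_pi_apply _

lemma strictMono_snoc {k : ℕ} {s : Fin k → ℝ} {t : ℝ} (hs : StrictMono s) (ht : ∀ i, s i < t) :
    StrictMono (Fin.snoc s t : Fin (k + 1) → ℝ) := by
  intro i j hij
  induction j using Fin.lastCases with
  | last =>
    induction i using Fin.lastCases with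
    | last => exact absurd hij (lt_irrefl _)
    | cast i => simpa using ht i
  | cast j =>
    induction i using Fin.lastCases with
    | last => exact absurd hij (not_lt.2 (Fin.le_last _))
    | cast i => simpa using hs (Fin.castSucc_lt_castSucc_iff.1 hij)

lemma bridgeDensity_pos {k : ℕ} {t : ℝ} (ht : 0 < t) (a b : Euc d) {s : Fin k → ℝ}
    (hs : StrictMono s) (hp : ∀ i, 0 < s i ∧ s i < t) (z : Fin k → Euc d) :
    0 < bridgeDensity d t a b s z := by
  refine div_pos (jointDensity_pos _ (strictMono_snoc hs fun i => (hp i).2) (fun i => ?_) _)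
    (heatKernel_pos ht _)
  induction i using Fin.lastCases with
  | last => simpa using ht
  | cast i => simpa using (hp i).1

lemma measurable_bridgeDensity {k : ℕ} (t : ℝ) (a b : Euc d) (s : Fin k → ℝ) :
    Measurable (bridgeDensity d t a b s) := by
  unfold bridgeDensity
  refine ((measurable_jointDensity a (Fin.snoc s t)).comp ?_).div_const _
  refine measurable_pi_iff.2 fun i => ?_
  induction i using Fin.lastCases with
  | last => simp
  | cast i => simpa using measurable_pi_apply i

/-- Density, at the starting and end values `p₀ = (z₁, z₂)`, `p₁ = (w₁, w₂)` of two path pieces,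
of the two outer pieces of a bridge from `a` to `b` in time `t`, separated by a gap `g` and
starting at distance `ε` from the ends, with respect to two independent Brownian motions from `x`
and `y` observed from time `η` on. -/
def gapDensity (d : ℕ) (ε η g t : ℝ) (a b x y : Euc d) (p₀ p₁ : Euc d × Euc d) : ℝ :=
  heatKernel d ε (p₀.1 - a) / heatKernel d η (p₀.1 - x) *
    (heatKernel d ε (p₀.2 - b) / heatKernel d η (p₀.2 - y)) *
    (heatKernel d g (p₁.2 - p₁.1) / heatKernel d t (b - a))

lemma measurable_gapDensity (ε η g t : ℝ) (a b x y : Euc d) :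
    Measurable fun p : (Euc d × Euc d) × (Euc d × Euc d) =>
      gapDensity d ε η g t a b x y p.1 p.2 := by
  unfold gapDensity
  fun_prop

lemma gapDensity_nonneg {ε η g t : ℝ} (hε : 0 < ε) (hη : 0 < η) (hg : 0 < g) (ht : 0 < t)
    (a b x y : Euc d) (p₀ p₁ : Euc d × Euc d) : 0 ≤ gapDensity d ε η g t a b x y p₀ p₁ := by
  unfold gapDensity
  have h1 := heatKernel_pos hε (p₀.1 - a)
  have h2 := heatKernel_pos hε (p₀.2 - b)
  have h3 := heatKernel_pos hη (p₀.1 - x)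
  have h4 := heatKernel_pos hη (p₀.2 - y)
  have h5 := heatKernel_pos hg (p₁.2 - p₁.1)
  have h6 := heatKernel_pos ht (b - a)
  positivity

/-- Times of the two outer pieces of a bridge, in increasing order. -/
def bridgeTimes (m : ℕ) (ε c₁ c₂ t : ℝ) (u : ℕ → ℝ) (i : ℕ) : ℝ :=
  if i ≤ m then ε + c₁ * u i else t - ε - c₂ * u (2 * m + 1 - i)

/-- Two sequences of points arranged as the values of a bridge at `bridgeTimes`. -/
def bridgePoints (m : ℕ) (z₁ z₂ : ℕ → Euc d) (i : ℕ) : Euc d :=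
  if i ≤ m then z₁ i else z₂ (2 * m + 1 - i)

lemma prod_range_two_pieces (m : ℕ) (f : ℕ → ℝ) :
    ∏ i ∈ Finset.range (m + 1 + (m + 1) + 1), f i =
      f 0 * (∏ i ∈ Finset.range m, f (i + 1)) * f (m + 1) *
        (∏ i ∈ Finset.range m, f (2 * m + 1 - i)) * f (2 * m + 2) := by
  have h : ∏ i ∈ Finset.range m, f (2 * m + 1 - i) = ∏ i ∈ Finset.range m, f (m + 2 + i) := by
    rw [← Finset.prod_range_reflect]
    refine Finset.prod_congr rfl fun i hi => ?_
    rw [Finset.mem_range] at hi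
    congr 1; omega
  rw [h, Finset.prod_range_succ, show m + 1 + (m + 1) = m + 2 + m by ring, Finset.prod_range_add,
    Finset.prod_range_succ, Finset.prod_range_succ', show m + 2 + m = 2 * m + 2 by ring]
  ring

lemma jointDensity_piece (m : ℕ) (η c : ℝ) (x : Euc d) (u : ℕ → ℝ) (hu : u 0 = 0)
    (z : ℕ → Euc d) :
    jointDensity d x (fun i : Fin (m + 1) => η + c * u i) (fun i => z i) =
      heatKernel d η (z 0 - x) *
        ∏ i ∈ Finset.range m, heatKernel d (c * (u (i + 1) - u i)) (z (i + 1) - z i) := by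
  rw [jointDensity_eq_prod_range (σ := fun n => if n = 0 then 0 else η + c * u (n - 1))
    (ξ := fun n => if n = 0 then x else z (n - 1)) (by simp) (by simp) (by simp) (by simp),
    Finset.prod_range_succ']
  rw [mul_comm]
  simp [hu]
  left
  refine Finset.prod_congr rfl fun i _ => ?_
  congr 1; ring

lemma bridgeDensity_eq (m : ℕ) {ε η c₁ c₂ g t : ℝ} (hη : 0 < η)
    (htot : t = ε + c₁ + g + c₂ + ε) (a b x y : Euc d) (u : ℕ → ℝ) (hu : u 0 = 0) (hu' : u m = 1)
    (z₁ z₂ : ℕ → Euc d) :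
    bridgeDensity d t a b
        (fun i : Fin (m + 1 + (m + 1)) => bridgeTimes m ε c₁ c₂ t u i)
        (fun i => bridgePoints m z₁ z₂ i) =
      gapDensity d ε η g t a b x y (z₁ 0, z₂ 0) (z₁ m, z₂ m) *
        (jointDensity d x (fun i : Fin (m + 1) => η + c₁ * u i) (fun i => z₁ i) *
        jointDensity d y (fun i : Fin (m + 1) => η + c₂ * u i) (fun i => z₂ i)) := by
  have h3 := (heatKernel_pos hη (z₁ 0 - x)).ne'
  have h4 := (heatKernel_pos hη (z₂ 0 - y)).ne'
  rw [jointDensity_piece m η c₁ x u hu z₁, jointDensity_piece m η c₂ y u hu z₂]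
  unfold bridgeDensity gapDensity
  rw [jointDensity_eq_prod_range (x := a)
    (σ := fun n => if n = 0 then 0 else if n ≤ m + 1 + (m + 1) then
      bridgeTimes m ε c₁ c₂ t u (n - 1) else t)
    (ξ := fun n => if n = 0 then a else if n ≤ m + 1 + (m + 1) then
      bridgePoints m z₁ z₂ (n - 1) else b) (by simp) (by simp)]
  rotate_left
  · intro i
    induction i using Fin.lastCases with
    | last => simp
    | cast i => simp [Nat.succ_le_of_lt i.isLt]
  · intro i
    induction i using Fin.lastCases with
    | last => simp
    | cast i => simp [Nat.succ_le_of_lt i.isLt]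
  rw [prod_range_two_pieces]
  have e1 : ∀ i ∈ Finset.range m, 2 * m + 1 - i ≠ 0 ∧ 2 * m + 1 - i ≤ m + 1 + (m + 1) ∧
      2 * m + 1 - i + 1 ≤ m + 1 + (m + 1) ∧ ¬ (2 * m + 1 - i - 1 ≤ m) ∧ ¬ (2 * m + 1 - i ≤ m) ∧
      2 * m + 1 - (2 * m + 1 - i - 1) = i + 1 ∧ 2 * m + 1 - (2 * m + 1 - i) = i := by
    intro i hi
    rw [Finset.mem_range] at hi
    omega
  have e2 : ∀ i ∈ Finset.range m, i + 1 ≤ m + 1 + (m + 1) ∧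
      i + 1 + 1 ≤ m + 1 + (m + 1) ∧ i ≤ m ∧ i + 1 ≤ m := by
    intro i hi
    rw [Finset.mem_range] at hi
    omega
  have p1 := Finset.prod_congr (s₁ := Finset.range m) rfl (fun i hi =>
    show heatKernel d
      ((if i + 1 + 1 = 0 then 0 else if i + 1 + 1 ≤ m + 1 + (m + 1) then
        bridgeTimes m ε c₁ c₂ t u (i + 1 + 1 - 1) else t) -
        (if i + 1 = 0 then 0 else if i + 1 ≤ m + 1 + (m + 1) then
        bridgeTimes m ε c₁ c₂ t u (i + 1 - 1) else t))
      ((if i + 1 + 1 = 0 then a else if i + 1 + 1 ≤ m + 1 + (m + 1) then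
        bridgePoints m z₁ z₂ (i + 1 + 1 - 1) else b) -
        (if i + 1 = 0 then a else if i + 1 ≤ m + 1 + (m + 1) then
        bridgePoints m z₁ z₂ (i + 1 - 1) else b)) =
      heatKernel d (c₁ * (u (i + 1) - u i)) (z₁ (i + 1) - z₁ i) by
    obtain ⟨h1, h2, h3, h4⟩ := e2 i hi
    simp only [Nat.add_eq_zero_iff, one_ne_zero, and_false, if_false, h1, h2, if_true,
      bridgeTimes, bridgePoints, Nat.add_sub_cancel, h3, h4]
    congr 1; ring)
  have p2 := Finset.prod_congr (s₁ := Finset.range m) rfl (fun i hi =>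
    show heatKernel d
      ((if 2 * m + 1 - i + 1 = 0 then 0 else if 2 * m + 1 - i + 1 ≤ m + 1 + (m + 1) then
        bridgeTimes m ε c₁ c₂ t u (2 * m + 1 - i + 1 - 1) else t) -
        (if 2 * m + 1 - i = 0 then 0 else if 2 * m + 1 - i ≤ m + 1 + (m + 1) then
        bridgeTimes m ε c₁ c₂ t u (2 * m + 1 - i - 1) else t))
      ((if 2 * m + 1 - i + 1 = 0 then a else if 2 * m + 1 - i + 1 ≤ m + 1 + (m + 1) then
        bridgePoints m z₁ z₂ (2 * m + 1 - i + 1 - 1) else b) -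
        (if 2 * m + 1 - i = 0 then a else if 2 * m + 1 - i ≤ m + 1 + (m + 1) then
        bridgePoints m z₁ z₂ (2 * m + 1 - i - 1) else b)) =
      heatKernel d (c₂ * (u (i + 1) - u i)) (z₂ (i + 1) - z₂ i) by
    obtain ⟨h1, h2, h3, h4, h5, h6, h7⟩ := e1 i hi
    simp only [Nat.add_eq_zero_iff, one_ne_zero, and_false, if_false, h1, h2, h3, if_true,
      bridgeTimes, bridgePoints, Nat.add_sub_cancel, h4, h5, h6, h7]
    rw [heatKernel_sub_comm]
    congr 1; ring)
  rw [p1, p2]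
  have q1 : ¬ (2 * m + 2 + 1 ≤ m + 1 + (m + 1)) := by omega
  have q2 : 2 * m + 2 ≤ m + 1 + (m + 1) := by omega
  have q3 : ¬ (2 * m + 2 - 1 ≤ m) := by omega
  have q4 : 2 * m + 1 - (2 * m + 2 - 1) = 0 := by omega
  have q5 : m + 1 + 1 ≤ m + 1 + (m + 1) := by omega
  have q6 : 2 * m + 1 - (m + 1) = m := by omega
  have q7 : ¬ (m + 1 ≤ m) := by omega
  have q8 : m + 1 ≤ m + 1 + (m + 1) := by omega
  have q9 : 0 + 1 ≤ m + 1 + (m + 1) := by omega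
  have q10 : 0 + 1 - 1 = 0 := rfl
  simp only [Nat.add_eq_zero_iff, one_ne_zero, OfNat.ofNat_ne_zero, and_false, if_false, if_true,
    q1, q2, q3, q4, q5, q6, q7, q8, q9, q10, bridgeTimes, bridgePoints, Nat.add_sub_cancel, le_refl,
    Nat.zero_le, hu, hu']
  rw [heatKernel_sub_comm _ b, show ε + c₁ * 0 - 0 = ε by ring,
    show t - (t - ε - c₂ * 0) = ε by ring, show t - ε - c₂ * 1 - (ε + c₁ * 1) = g by
      rw [htot]; ring]
  field_simp
end

end

section

section
variable {α β γ δ : Type*} [MeasurableSpace α] [MeasurableSpace β] [MeasurableSpace γ]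
  [MeasurableSpace δ]

lemma map_withDensity_comp (μ : Measure α) {f : α → β} (hf : Measurable f)
    {g : β → ENNReal} (hg : Measurable g) :
    (μ.map f).withDensity g = (μ.withDensity (g ∘ f)).map f := by
  ext s hs
  rw [Measure.map_apply hf hs, withDensity_apply _ hs, withDensity_apply _ (hf hs),
    setLIntegral_map hs hg hf]
  rfl

lemma map_prodMk_prod {μ : Measure α} {ν : Measure β} [SFinite μ] [SFinite ν] {f : α → γ}
    {g : β → δ} (hf : AEMeasurable f μ) (hg : AEMeasurable g ν) :
    (μ.prod ν).map (fun z => (f z.1, g z.2)) = (μ.map f).prod (ν.map g) := by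
  rw [Measure.map_congr hf.ae_eq_mk, Measure.map_congr hg.ae_eq_mk,
    Measure.map_prod_map _ _ hf.measurable_mk hg.measurable_mk]
  refine Measure.map_congr ?_
  filter_upwards [Measure.quasiMeasurePreserving_fst.ae hf.ae_eq_mk,
    Measure.quasiMeasurePreserving_snd.ae hg.ae_eq_mk] with z h1 h2
  simp [Prod.map, h1, h2]

lemma aemeasurable_of_map_eq_withDensity {μ : Measure α} {ν : Measure β} [NeZero ν]
    {f : α → β} {ρ : β → ℝ} (hρ : Measurable ρ) (hpos : ∀ z, 0 < ρ z)
    (h : μ.map f = ν.withDensity fun z => ENNReal.ofReal (ρ z)) : AEMeasurable f μ := by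
  by_contra hf
  rw [Measure.map_of_not_aemeasurable hf, eq_comm,
    withDensity_eq_zero_iff hρ.ennreal_ofReal.aemeasurable] at h
  have h' : ∀ᵐ _ ∂ν, False := by
    filter_upwards [h] with z hz
    simp only [Pi.zero_apply, ENNReal.ofReal_eq_zero] at hz
    exact absurd hz (not_le.2 (hpos z))
  simp [NeZero.ne ν] at h'

end

section
variable {d : ℕ} {Ω Ω' : Type*} [MeasureSpace Ω] [MeasureSpace Ω']

lemma IsBrownianMotion.aemeasurable_fin {x : Euc d} {W : ℝ → Ω → Euc d}
    (hW : IsBrownianMotion x W) {k : ℕ} {s : Fin (k + 1) → ℝ} (hs : StrictMono s)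
    (hp : ∀ i, 0 < s i) : AEMeasurable (fun ω (i : Fin (k + 1)) => W (s i) ω) ℙ :=
  aemeasurable_of_map_eq_withDensity (measurable_jointDensity x s)
    (fun z => jointDensity_pos x hs hp z) (hW.2.2 k s hs hp)

lemma IsBrownianBridge.aemeasurable_fin {a b : Euc d} {t : ℝ} (ht : 0 < t) {X : ℝ → Ω → Euc d}
    (hX : IsBrownianBridge t a b X) {k : ℕ} {s : Fin (k + 1) → ℝ} (hs : StrictMono s)
    (hp : ∀ i, 0 < s i ∧ s i < t) : AEMeasurable (fun ω (i : Fin (k + 1)) => X (s i) ω) ℙ :=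
  aemeasurable_of_map_eq_withDensity (measurable_bridgeDensity t a b s)
    (fun z => bridgeDensity_pos ht a b hs hp z) (hX.2.2.2 k s hs hp)

lemma IsBrownianMotion.aemeasurable {x : Euc d} {W : ℝ → Ω → Euc d}
    (hW : IsBrownianMotion x W) {s : ℝ} (hs : 0 ≤ s) : AEMeasurable (W s) ℙ := by
  rcases hs.eq_or_lt with rfl | hs
  · rw [show W 0 = fun _ => x from funext hW.1]
    exact aemeasurable_const
  · exact aemeasurable_pi_iff.1 (hW.aemeasurable_fin (k := 0) (s := fun _ => s)
      (fun i j hij => absurd hij (by simp)) fun _ => hs) 0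

lemma IsBrownianBridge.aemeasurable {a b : Euc d} {t : ℝ} (ht : 0 < t) {X : ℝ → Ω → Euc d}
    (hX : IsBrownianBridge t a b X) {s : ℝ} (hs : 0 ≤ s) (hst : s ≤ t) :
    AEMeasurable (X s) ℙ := by
  rcases hs.eq_or_lt with rfl | hs
  · rw [show X 0 = fun _ => a from funext hX.1]
    exact aemeasurable_const
  rcases hst.eq_or_lt with rfl | hst
  · rw [show X s = fun _ => b from funext hX.2.1]
    exact aemeasurable_const
  · exact aemeasurable_pi_iff.1 (hX.aemeasurable_fin ht (k := 0) (s := fun _ => s)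
      (fun i j hij => absurd hij (by simp)) fun _ => ⟨hs, hst⟩) 0

/-- Index equivalence listing one block increasingly and a second one decreasingly. -/
def foldIndex (N : ℕ) : Fin N ⊕ Fin N ≃ Fin (N + N) :=
  (Equiv.sumCongr (Equiv.refl _) Fin.revPerm).trans finSumFinEquiv

/-- The corresponding concatenation of two blocks of points. -/
def foldPoints (d N : ℕ) : (Fin N → Euc d) × (Fin N → Euc d) ≃ᵐ (Fin (N + N) → Euc d) :=
  (MeasurableEquiv.sumPiEquivProdPi fun _ : Fin N ⊕ Fin N => Euc d).symm.trans
    (MeasurableEquiv.piCongrLeft (fun _ => Euc d) (foldIndex N))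

lemma foldPoints_inl (N : ℕ) (z : (Fin N → Euc d) × (Fin N → Euc d)) (i : Fin N) :
    foldPoints d N z (foldIndex N (.inl i)) = z.1 i := by
  simp only [foldPoints, MeasurableEquiv.trans_apply]
  rw [MeasurableEquiv.piCongrLeft_apply_apply]
  rfl

lemma foldPoints_inr (N : ℕ) (z : (Fin N → Euc d) × (Fin N → Euc d)) (i : Fin N) :
    foldPoints d N z (foldIndex N (.inr i)) = z.2 i := by
  simp only [foldPoints, MeasurableEquiv.trans_apply]
  rw [MeasurableEquiv.piCongrLeft_apply_apply]
  rfl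

lemma foldIndex_inl (N : ℕ) (i : Fin N) : (foldIndex N (.inl i) : ℕ) = i := by
  simp [foldIndex]

lemma foldIndex_inr (N : ℕ) (i : Fin N) :
    (foldIndex N (.inr i) : ℕ) = N + (N - (i + 1)) := by
  simp [foldIndex, add_comm]

lemma foldPoints_eq (m : ℕ) (z₁ z₂ : ℕ → Euc d) :
    foldPoints d (m + 1) (fun i => z₁ i, fun i => z₂ i) =
      fun i : Fin _ => bridgePoints m z₁ z₂ i := by
  funext i
  obtain ⟨j, rfl⟩ := (foldIndex (m + 1)).surjective i
  rcases j with j | j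
  · rw [foldPoints_inl, foldIndex_inl, bridgePoints, if_pos (Nat.lt_succ_iff.1 j.isLt)]
  · rw [foldPoints_inr, foldIndex_inr, bridgePoints, if_neg (by omega)]
    rw [show 2 * m + 1 - (m + 1 + (m + 1 - ((j : ℕ) + 1))) = j by omega]

lemma volume_map_foldPoints (N : ℕ) :
    (volume : Measure ((Fin N → Euc d) × (Fin N → Euc d))).map (foldPoints d N) = volume :=
  ((volume_measurePreserving_sumPiEquivProdPi_symm (fun _ : Fin N ⊕ Fin N => Euc d)).trans
    (volume_measurePreserving_piCongrLeft (fun _ => Euc d) (foldIndex N))).map_eq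


/-- Extension of a finite sequence by `0`. -/
def extendZero {N : ℕ} (z : Fin N → Euc d) (n : ℕ) : Euc d := if h : n < N then z ⟨n, h⟩ else 0

lemma extendZero_val {N : ℕ} (z : Fin N → Euc d) (i : Fin N) : extendZero z i = z i := by
  simp [extendZero]

lemma strictMono_bridgeTimes (m : ℕ) {ε c₁ c₂ g t : ℝ} (hc₁ : 0 < c₁) (hc₂ : 0 < c₂)
    (hg : 0 < g) (htot : t = ε + c₁ + g + c₂ + ε) {u : ℕ → ℝ} (hu : StrictMono u)
    (hum : u m = 1) :
    StrictMono fun i : Fin (m + 1 + (m + 1)) => bridgeTimes m ε c₁ c₂ t u i := by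
  intro i j hij
  have hij' : (i : ℕ) < j := hij
  have hi := i.isLt
  have hj := j.isLt
  simp only [bridgeTimes]
  split_ifs with h1 h2 h2
  · have := mul_lt_mul_of_pos_left (hu hij') hc₁
    linarith
  · have h3 := mul_le_mul_of_nonneg_left (hu.monotone h1) hc₁.le
    have h4 := mul_le_mul_of_nonneg_left
      (hu.monotone (show 2 * m + 1 - (j : ℕ) ≤ m by omega)) hc₂.le
    rw [hum] at h3 h4
    linarith
  · omega
  · have := mul_lt_mul_of_pos_left
      (hu (show 2 * m + 1 - (j : ℕ) < 2 * m + 1 - i by omega)) hc₂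
    linarith

lemma bridgeTimes_mem (m : ℕ) {ε c₁ c₂ g t : ℝ} (hε : 0 < ε) (hc₁ : 0 < c₁) (hc₂ : 0 < c₂)
    (hg : 0 < g) (htot : t = ε + c₁ + g + c₂ + ε) {u : ℕ → ℝ} (hu : StrictMono u)
    (hu0 : u 0 = 0) (hum : u m = 1) (i : Fin (m + 1 + (m + 1))) :
    0 < bridgeTimes m ε c₁ c₂ t u i ∧ bridgeTimes m ε c₁ c₂ t u i < t := by
  have hi := i.isLt
  simp only [bridgeTimes]
  split_ifs with h
  · have h1 := mul_le_mul_of_nonneg_left (hu.monotone h) hc₁.le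
    have h2 := mul_le_mul_of_nonneg_left (hu.monotone (Nat.zero_le i)) hc₁.le
    rw [hum] at h1
    rw [hu0] at h2
    constructor <;> linarith
  · have h1 := mul_le_mul_of_nonneg_left
      (hu.monotone (show 2 * m + 1 - (i : ℕ) ≤ m by omega)) hc₂.le
    have h2 := mul_le_mul_of_nonneg_left
      (hu.monotone (Nat.zero_le (2 * m + 1 - (i : ℕ)))) hc₂.le
    rw [hum] at h1
    rw [hu0] at h2
    constructor <;> linarith


/-- Two finite sequences seen as a sequence of pairs. -/
def zipPoints (d N : ℕ) (z : (Fin N → Euc d) × (Fin N → Euc d)) (i : Fin N) : Euc d × Euc d :=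
  (z.1 i, z.2 i)

lemma measurable_zipPoints (N : ℕ) : Measurable (zipPoints d N) :=
  measurable_pi_iff.2 fun i => ((measurable_pi_apply i).comp measurable_fst).prodMk
    ((measurable_pi_apply i).comp measurable_snd)

lemma strictMono_add_mul {u : ℕ → ℝ} (hu : StrictMono u) (η : ℝ) {c : ℝ} (hc : 0 < c) (m : ℕ) :
    StrictMono fun i : Fin (m + 1) => η + c * u i := by
  intro i j hij
  have := mul_lt_mul_of_pos_left (hu (show (i : ℕ) < j from hij)) hc
  simp only; linarith

lemma add_mul_pos {u : ℕ → ℝ} (hu : StrictMono u) (hu0 : u 0 = 0) {η c : ℝ} (hη : 0 < η)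
    (hc : 0 < c) (i : ℕ) : 0 < η + c * u i := by
  have := mul_le_mul_of_nonneg_left (hu.monotone (Nat.zero_le i)) hc.le
  rw [hu0] at this
  linarith

lemma brownian_pair_grid_law [IsProbabilityMeasure (ℙ : Measure Ω')]
    {x y : Euc d} {η c₁ c₂ : ℝ} (hη : 0 < η) (hc₁ : 0 < c₁) (hc₂ : 0 < c₂)
    {W W' : ℝ → Ω' → Euc d} (hW : IsBrownianMotion x W) (hW' : IsBrownianMotion y W')
    {m : ℕ} {u : ℕ → ℝ} (hu : StrictMono u) (hu0 : u 0 = 0) :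
    Measure.map (fun (z : Ω' × Ω') (i : Fin (m + 1)) =>
      (W (η + c₁ * u i) z.1, W' (η + c₂ * u i) z.2)) ((ℙ : Measure Ω').prod ℙ) =
      Measure.map (zipPoints d (m + 1))
        ((volume : Measure ((Fin (m + 1) → Euc d) × (Fin (m + 1) → Euc d))).withDensity
        fun z => ENNReal.ofReal (jointDensity d x (fun i : Fin (m + 1) => η + c₁ * u i) z.1) *
          ENNReal.ofReal (jointDensity d y (fun i : Fin (m + 1) => η + c₂ * u i) z.2)) := by
  have hm₁ := strictMono_add_mul hu η hc₁ m
  have hm₂ := strictMono_add_mul hu η hc₂ m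
  have hp₁ := fun i : Fin (m + 1) => add_mul_pos hu hu0 hη hc₁ i
  have hp₂ := fun i : Fin (m + 1) => add_mul_pos hu hu0 hη hc₂ i
  have h1 := hW.aemeasurable_fin hm₁ hp₁
  have h2 := hW'.aemeasurable_fin hm₂ hp₂
  rw [Measure.volume_eq_prod, ← prod_withDensity
    (measurable_jointDensity x _).ennreal_ofReal (measurable_jointDensity y _).ennreal_ofReal,
    ← hW.2.2 m _ hm₁ hp₁, ← hW'.2.2 m _ hm₂ hp₂,
    ← map_prodMk_prod h1 h2, AEMeasurable.map_map_of_aemeasurable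
      (measurable_zipPoints _).aemeasurable (h1.comp_fst.prodMk h2.comp_snd)]
  rfl

lemma bridge_map_grid {a b : Euc d} {ε c₁ c₂ g t : ℝ} (hε : 0 < ε) (hc₁ : 0 < c₁) (hc₂ : 0 < c₂)
    (hg : 0 < g) (htot : t = ε + c₁ + g + c₂ + ε)
    {X : ℝ → Ω → Euc d} (hX : IsBrownianBridge t a b X)
    {m : ℕ} {u : ℕ → ℝ} (hu : StrictMono u) (hu0 : u 0 = 0) (hum : u m = 1) :
    Measure.map (fun ω (i : Fin (m + 1)) =>
      (X (ε + c₁ * u i) ω, X (t - ε - c₂ * u i) ω)) (ℙ : Measure Ω) =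
    Measure.map (zipPoints d (m + 1)) ((volume : Measure ((Fin (m + 1) → Euc d) ×
      (Fin (m + 1) → Euc d))).withDensity fun z => ENNReal.ofReal (bridgeDensity d t a b
        (fun i : Fin (m + 1 + (m + 1)) => bridgeTimes m ε c₁ c₂ t u i)
        (foldPoints d (m + 1) z))) := by
  have ht : 0 < t := by linarith
  have hsm := strictMono_bridgeTimes m (ε := ε) hc₁ hc₂ hg htot hu hum
  have hmem := bridgeTimes_mem m hε hc₁ hc₂ hg htot hu hu0 hum
  have hXm : AEMeasurable (fun ω (i : Fin (m + 1 + (m + 1))) =>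
    X (bridgeTimes m ε c₁ c₂ t u i) ω) ℙ := hX.aemeasurable_fin (k := m + 1 + m) ht hsm hmem
  have hlaw : Measure.map (fun ω (i : Fin (m + 1 + (m + 1))) =>
      X (bridgeTimes m ε c₁ c₂ t u i) ω) ℙ = (volume : Measure (Fin (m + 1 + (m + 1)) →
      Euc d)).withDensity fun z => ENNReal.ofReal (bridgeDensity d t a b
        (fun i : Fin (m + 1 + (m + 1)) => bridgeTimes m ε c₁ c₂ t u i) z) :=
    hX.2.2.2 (m + 1 + m) _ hsm hmem
  have hL : Measure.map (fun ω (i : Fin (m + 1)) =>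
      (X (ε + c₁ * u i) ω, X (t - ε - c₂ * u i) ω)) (ℙ : Measure Ω) =
      Measure.map (zipPoints d (m + 1)) (Measure.map (foldPoints d (m + 1)).symm
        (Measure.map (fun ω (i : Fin (m + 1 + (m + 1))) =>
          X (bridgeTimes m ε c₁ c₂ t u i) ω) ℙ)) := by
    rw [AEMeasurable.map_map_of_aemeasurable
        (foldPoints d (m + 1)).symm.measurable.aemeasurable hXm,
      AEMeasurable.map_map_of_aemeasurable (measurable_zipPoints _).aemeasurable
        ((foldPoints d (m + 1)).symm.measurable.comp_aemeasurable hXm)]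
    congr 1
    funext ω i
    set ζ : Fin (m + 1 + (m + 1)) → Euc d := fun i => X (bridgeTimes m ε c₁ c₂ t u i) ω with hζ
    have e1 := foldPoints_inl (m + 1) ((foldPoints d (m + 1)).symm ζ) i
    have e2 := foldPoints_inr (m + 1) ((foldPoints d (m + 1)).symm ζ) i
    rw [MeasurableEquiv.apply_symm_apply] at e1 e2
    simp only [Function.comp, zipPoints]
    rw [← hζ, ← e1, ← e2]
    simp only [hζ, foldIndex_inl, foldIndex_inr, bridgeTimes]
    have hi := i.isLt
    rw [if_pos (by omega), if_neg (by omega),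
      show 2 * m + 1 - (m + 1 + (m + 1 - ((i : ℕ) + 1))) = i by omega]
  have hbm : Measurable fun z => ENNReal.ofReal (bridgeDensity d t a b
      (fun i : Fin (m + 1 + (m + 1)) => bridgeTimes m ε c₁ c₂ t u i) z) :=
    (measurable_bridgeDensity t a b _).ennreal_ofReal
  rw [hL, hlaw, ← volume_map_foldPoints (m + 1),
    map_withDensity_comp _ (foldPoints d (m + 1)).measurable hbm,
    Measure.map_map (foldPoints d (m + 1)).symm.measurable (foldPoints d (m + 1)).measurable,
    (foldPoints d (m + 1)).symm_comp_self, Measure.map_id]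
  rfl

lemma bridgeDensity_foldPoints {a b x y : Euc d} {ε η c₁ c₂ g t : ℝ} (hη : 0 < η)
    (htot : t = ε + c₁ + g + c₂ + ε) {m : ℕ} {u : ℕ → ℝ} (hu0 : u 0 = 0) (hum : u m = 1)
    (z : (Fin (m + 1) → Euc d) × (Fin (m + 1) → Euc d)) :
    bridgeDensity d t a b (fun i : Fin (m + 1 + (m + 1)) => bridgeTimes m ε c₁ c₂ t u i)
      (foldPoints d (m + 1) z) =
    gapDensity d ε η g t a b x y (zipPoints d (m + 1) z 0) (zipPoints d (m + 1) z (Fin.last m)) *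
      (jointDensity d x (fun i : Fin (m + 1) => η + c₁ * u i) z.1 *
        jointDensity d y (fun i : Fin (m + 1) => η + c₂ * u i) z.2) := by
  have key := bridgeDensity_eq m hη htot a b x y u hu0 hum (extendZero z.1) (extendZero z.2)
  rw [← foldPoints_eq] at key
  have e1 : (fun i : Fin (m + 1) => extendZero z.1 i) = z.1 := funext fun i => extendZero_val z.1 i
  have e2 : (fun i : Fin (m + 1) => extendZero z.2 i) = z.2 := funext fun i => extendZero_val z.2 i
  have f1 : extendZero z.1 0 = z.1 0 := extendZero_val z.1 0
  have f2 : extendZero z.2 0 = z.2 0 := extendZero_val z.2 0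
  have g1 : extendZero z.1 m = z.1 (Fin.last m) := extendZero_val z.1 (Fin.last m)
  have g2 : extendZero z.2 m = z.2 (Fin.last m) := extendZero_val z.2 (Fin.last m)
  rw [e1, e2, f1, f2, g1, g2] at key
  exact key

lemma measurable_gapDensity_pi {a b x y : Euc d} {ε η g t : ℝ} (m : ℕ) :
    Measurable fun p : Fin (m + 1) → Euc d × Euc d =>
      ENNReal.ofReal (gapDensity d ε η g t a b x y (p 0) (p (Fin.last m))) := by
  have h : Measurable fun p : Fin (m + 1) → Euc d × Euc d => (p 0, p (Fin.last m)) := by fun_prop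
  exact ((measurable_gapDensity ε η g t a b x y).comp h).ennreal_ofReal

/-- The finite-dimensional laws of the outer pieces of a bridge have density `gapDensity` with
respect to those of two independent Brownian motions. -/
lemma bridge_grid_law [IsProbabilityMeasure (ℙ : Measure Ω')]
    {a b x y : Euc d} {ε η c₁ c₂ g t : ℝ} (hε : 0 < ε) (hη : 0 < η) (hc₁ : 0 < c₁) (hc₂ : 0 < c₂)
    (hg : 0 < g) (htot : t = ε + c₁ + g + c₂ + ε)
    {X : ℝ → Ω → Euc d} (hX : IsBrownianBridge t a b X)
    {W W' : ℝ → Ω' → Euc d} (hW : IsBrownianMotion x W) (hW' : IsBrownianMotion y W')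
    {m : ℕ} {u : ℕ → ℝ} (hu : StrictMono u) (hu0 : u 0 = 0) (hum : u m = 1) :
    Measure.map (fun ω (i : Fin (m + 1)) => (X (ε + c₁ * u i) ω, X (t - ε - c₂ * u i) ω)) ℙ =
      (Measure.map (fun (z : Ω' × Ω') (i : Fin (m + 1)) =>
        (W (η + c₁ * u i) z.1, W' (η + c₂ * u i) z.2))
        ((ℙ : Measure Ω').prod ℙ)).withDensity
        fun p => ENNReal.ofReal (gapDensity d ε η g t a b x y (p 0) (p (Fin.last m))) := by
  have ht : 0 < t := by linarith
  have hΔm := measurable_gapDensity_pi (ε := ε) (η := η) (g := g) (t := t) (a := a) (b := b)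
    (x := x) (y := y) m
  have hJ : Measurable fun z : (Fin (m + 1) → Euc d) × (Fin (m + 1) → Euc d) =>
      ENNReal.ofReal (jointDensity d x (fun i : Fin (m + 1) => η + c₁ * u i) z.1) *
        ENNReal.ofReal (jointDensity d y (fun i : Fin (m + 1) => η + c₂ * u i) z.2) :=
    ((measurable_jointDensity x _).comp measurable_fst).ennreal_ofReal.mul
      ((measurable_jointDensity y _).comp measurable_snd).ennreal_ofReal
  have hD : (fun z => ENNReal.ofReal (bridgeDensity d t a b
        (fun i : Fin (m + 1 + (m + 1)) => bridgeTimes m ε c₁ c₂ t u i)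
        (foldPoints d (m + 1) z))) =
      (fun z => ENNReal.ofReal (jointDensity d x (fun i : Fin (m + 1) => η + c₁ * u i) z.1) *
        ENNReal.ofReal (jointDensity d y (fun i : Fin (m + 1) => η + c₂ * u i) z.2)) *
      ((fun p : Fin (m + 1) → Euc d × Euc d =>
        ENNReal.ofReal (gapDensity d ε η g t a b x y (p 0) (p (Fin.last m)))) ∘
        zipPoints d (m + 1)) := by
    funext z
    rw [bridgeDensity_foldPoints (x := x) (y := y) hη htot hu0 hum z,
      ENNReal.ofReal_mul (gapDensity_nonneg hε hη hg ht _ _ _ _ _ _),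
      ENNReal.ofReal_mul (jointDensity_pos x (strictMono_add_mul hu η hc₁ m)
        (fun i => add_mul_pos hu hu0 hη hc₁ i) _).le, mul_comm]
    rfl
  rw [bridge_map_grid hε hc₁ hc₂ hg htot hX hu hu0 hum,
    brownian_pair_grid_law hη hc₁ hc₂ hW hW' hu hu0,
    map_withDensity_comp _ (measurable_zipPoints _) hΔm, ← withDensity_mul₀ hJ.aemeasurable
      (hΔm.comp (measurable_zipPoints _)).aemeasurable, hD]
end

end

section

section
variable {d : ℕ} {Ω Ω' : Type*} [MeasureSpace Ω] [MeasureSpace Ω']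

lemma add_mul_mem_of_mem {c₁ c₂ g ε t s : ℝ} (hε : 0 < ε) (hc₁ : 0 < c₁) (hc₂ : 0 < c₂)
    (hg : 0 < g) (htot : t = ε + c₁ + g + c₂ + ε) (hs : s ∈ Set.Icc (0 : ℝ) 1) :
    ε + c₁ * s ∈ Set.Icc 0 t ∧ t - ε - c₂ * s ∈ Set.Icc 0 t := by
  have h1 := mul_nonneg hc₁.le hs.1
  have h2 := mul_nonneg hc₂.le hs.1
  have h3 := mul_le_mul_of_nonneg_left hs.2 hc₁.le
  have h4 := mul_le_mul_of_nonneg_left hs.2 hc₂.le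
  exact ⟨⟨by linarith, by linarith⟩, by linarith, by linarith⟩

lemma cast_mem_Icc (q : Set.Icc (0 : ℚ) 1) : ((q : ℚ) : ℝ) ∈ Set.Icc (0 : ℝ) 1 :=
  ⟨by exact_mod_cast q.2.1, by exact_mod_cast q.2.2⟩

lemma IsBrownianBridge.aemeasurable_piece {a b : Euc d} {ε c₁ c₂ g t : ℝ} (hε : 0 < ε)
    (hc₁ : 0 < c₁) (hc₂ : 0 < c₂) (hg : 0 < g) (htot : t = ε + c₁ + g + c₂ + ε)
    {X : ℝ → Ω → Euc d} (hX : IsBrownianBridge t a b X) :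
    AEMeasurable (fun ω (q : Set.Icc (0 : ℚ) 1) =>
      (X (ε + c₁ * (q : ℚ)) ω, X (t - ε - c₂ * (q : ℚ)) ω)) ℙ := by
  refine aemeasurable_pi_iff.2 fun q => ?_
  obtain ⟨h1, h2⟩ := add_mul_mem_of_mem hε hc₁ hc₂ hg htot (cast_mem_Icc q)
  have ht : 0 < t := by linarith
  exact (hX.aemeasurable ht h1.1 h1.2).prodMk (hX.aemeasurable ht h2.1 h2.2)

lemma IsBrownianMotion.aemeasurable_piece [SFinite (ℙ : Measure Ω')] {x y : Euc d}
    {η c₁ c₂ : ℝ} (hη : 0 < η) (hc₁ : 0 < c₁) (hc₂ : 0 < c₂)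
    {W W' : ℝ → Ω' → Euc d} (hW : IsBrownianMotion x W) (hW' : IsBrownianMotion y W') :
    AEMeasurable (fun (z : Ω' × Ω') (q : Set.Icc (0 : ℚ) 1) =>
      (W (η + c₁ * (q : ℚ)) z.1, W' (η + c₂ * (q : ℚ)) z.2)) ((ℙ : Measure Ω').prod ℙ) := by
  refine aemeasurable_pi_iff.2 fun q => ?_
  have h0 := (cast_mem_Icc q).1
  exact ((hW.aemeasurable (by positivity)).comp_fst).prodMk
    ((hW'.aemeasurable (by positivity)).comp_snd)

/-- The law of the two outer pieces of a bridge on path space, as an explicit density with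
respect to the law of two independent Brownian motions. -/
lemma bridge_path_law [IsProbabilityMeasure (ℙ : Measure Ω)] [IsProbabilityMeasure (ℙ : Measure Ω')]
    {a b x y : Euc d} {ε η c₁ c₂ g t : ℝ} (hε : 0 < ε) (hη : 0 < η) (hc₁ : 0 < c₁) (hc₂ : 0 < c₂)
    (hg : 0 < g) (htot : t = ε + c₁ + g + c₂ + ε)
    {X : ℝ → Ω → Euc d} (hX : IsBrownianBridge t a b X)
    {W W' : ℝ → Ω' → Euc d} (hW : IsBrownianMotion x W) (hW' : IsBrownianMotion y W') :
    Measure.map (fun ω (q : Set.Icc (0 : ℚ) 1) =>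
        (X (ε + c₁ * (q : ℚ)) ω, X (t - ε - c₂ * (q : ℚ)) ω)) ℙ =
      (Measure.map (fun (z : Ω' × Ω') (q : Set.Icc (0 : ℚ) 1) =>
        (W (η + c₁ * (q : ℚ)) z.1, W' (η + c₂ * (q : ℚ)) z.2))
        ((ℙ : Measure Ω').prod ℙ)).withDensity
        fun p => ENNReal.ofReal (gapDensity d ε η g t a b x y (p 0) (p 1)) := by
  have hX1 := hX.aemeasurable_piece hε hc₁ hc₂ hg htot
  have hW1 := IsBrownianMotion.aemeasurable_piece hη hc₁ hc₂ hW hW'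
  have : IsProbabilityMeasure (Measure.map (fun ω (q : Set.Icc (0 : ℚ) 1) =>
        (X (ε + c₁ * (q : ℚ)) ω, X (t - ε - c₂ * (q : ℚ)) ω)) (ℙ : Measure Ω)) :=
    Measure.isProbabilityMeasure_map hX1
  refine (measure_ext_of_grid fun m => ?_).symm
  have hu : StrictMono fun i : ℕ => (i : ℝ) / ((m : ℝ) + 1) := fun i j hij => by
    simp only
    gcongr
  have hum : ((m + 1 : ℕ) : ℝ) / ((m : ℝ) + 1) = 1 := by
    rw [Nat.cast_succ]; exact div_self (by positivity)
  have key := bridge_grid_law hε hη hc₁ hc₂ hg htot hX hW hW' (m := m + 1) hu (by simp) hum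
  have hD : (fun p : Set.Icc (0 : ℚ) 1 → Euc d × Euc d =>
      ENNReal.ofReal (gapDensity d ε η g t a b x y (p 0) (p 1))) =
      (fun p : Fin (m + 1 + 1) → Euc d × Euc d =>
        ENNReal.ofReal (gapDensity d ε η g t a b x y (p 0) (p (Fin.last (m + 1))))) ∘
        gridRestrict m := by
    funext p
    have h0 : gridRestrict m p 0 = p 0 := by
      unfold gridRestrict; congr 1; ext; simp
    have h1 : gridRestrict m p (Fin.last (m + 1)) = p 1 := by
      unfold gridRestrict; congr 1; ext
      simp only [Fin.val_last, Set.Icc.coe_one]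
      rw [Nat.cast_succ]; exact div_self (by positivity)
    simp only [Function.comp, h0, h1]
  rw [hD, ← map_withDensity_comp _ (measurable_gridRestrict m) (measurable_gapDensity_pi (m + 1)),
    AEMeasurable.map_map_of_aemeasurable (measurable_gridRestrict m).aemeasurable hX1,
    AEMeasurable.map_map_of_aemeasurable (measurable_gridRestrict m).aemeasurable hW1]
  convert key.symm using 3
  · funext z i
    simp [gridRestrict]
  · ext1 i
    simp [gridRestrict]

/-- Integral of `h` along the path with restriction `p` to the rationals. -/
def pathFunctional {F : Type*} [TopologicalSpace F] [Nonempty F] (h : F → ℝ)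
    (p : Set.Icc (0 : ℚ) 1 → F) : ℝ :=
  ∫ s in Set.Ioc (0 : ℝ) 1, h (pathExt (fun q : ℚ => p (Set.projIcc 0 1 zero_le_one q)) s)

section
variable {F : Type*} [MetricSpace F] [Nonempty F]

lemma measurable_pathFunctional [CompleteSpace F] [SecondCountableTopology F]
    [MeasurableSpace F] [BorelSpace F] {h : F → ℝ} (hh : Measurable h) :
    Measurable (pathFunctional h) := by
  have h1 : Measurable fun z : (Set.Icc (0 : ℚ) 1 → F) × ℝ =>
      h (pathExt (fun q : ℚ => z.1 (Set.projIcc 0 1 zero_le_one q)) z.2) := by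
    have h2 : Measurable fun z : (Set.Icc (0 : ℚ) 1 → F) × ℝ =>
        ((fun q : ℚ => z.1 (Set.projIcc 0 1 zero_le_one q), z.2) : (ℚ → F) × ℝ) := by
      fun_prop
    exact hh.comp (measurable_pathExt.comp h2)
  exact (h1.stronglyMeasurable.integral_prod_right
    (ν := volume.restrict (Set.Ioc (0 : ℝ) 1))).measurable

lemma pathFunctional_eq (h : F → ℝ) {f : ℝ → F} (hf : ContinuousOn f (Set.Icc 0 1)) :
    pathFunctional h (fun q => f (q : ℚ)) = ∫ s in Set.Ioc (0 : ℝ) 1, h (f s) := by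
  have hc : Continuous fun s : ℝ => f (Set.projIcc (0 : ℝ) 1 zero_le_one s) :=
    hf.comp_continuous (continuous_subtype_val.comp continuous_projIcc) fun s => Subtype.coe_prop _
  have he : (fun q : ℚ => f ((Set.projIcc (0 : ℚ) 1 zero_le_one q : ℚ) : ℝ)) =
      fun q : ℚ => f (Set.projIcc (0 : ℝ) 1 zero_le_one (q : ℝ)) := by
    funext q
    simp [Set.projIcc]
  refine setIntegral_congr_fun measurableSet_Ioc fun s hs => ?_
  simp only [he]
  rw [pathExt_eq hc, Set.projIcc_of_mem _ ⟨hs.1.le, hs.2⟩]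

end

lemma integral_Ioc_add_mul (f : ℝ → ℝ) (e : ℝ) {c : ℝ} (hc : 0 < c) :
    ∫ s in Set.Ioc e (e + c), f s = c * ∫ s in Set.Ioc (0 : ℝ) 1, f (e + c * s) := by
  rw [← intervalIntegral.integral_of_le (by linarith),
    ← intervalIntegral.integral_of_le zero_le_one,
    intervalIntegral.mul_integral_comp_add_mul]
  simp

lemma integral_Ioc_sub_mul (f : ℝ → ℝ) (e : ℝ) {c : ℝ} (hc : 0 < c) :
    ∫ s in Set.Ioc (e - c) e, f s = c * ∫ s in Set.Ioc (0 : ℝ) 1, f (e - c * s) := by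
  rw [← intervalIntegral.integral_of_le (by linarith),
    ← intervalIntegral.integral_of_le zero_le_one,
    intervalIntegral.mul_integral_comp_sub_mul]
  simp

/-- Expectations of functionals of the two outer pieces of a bridge, in terms of two independent
Brownian motions. -/
lemma bridge_lintegral [IsProbabilityMeasure (ℙ : Measure Ω)]
    [IsProbabilityMeasure (ℙ : Measure Ω')]
    {a b x y : Euc d} {ε η c₁ c₂ g t : ℝ} (hε : 0 < ε) (hη : 0 < η) (hc₁ : 0 < c₁) (hc₂ : 0 < c₂)
    (hg : 0 < g) (htot : t = ε + c₁ + g + c₂ + ε)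
    {X : ℝ → Ω → Euc d} (hX : IsBrownianBridge t a b X)
    {W W' : ℝ → Ω' → Euc d} (hW : IsBrownianMotion x W) (hW' : IsBrownianMotion y W')
    {h : Euc d → ℝ} (hh : Measurable h) {G : ℝ × ℝ → ENNReal} (hG : Measurable G) :
    ∫⁻ ω, G (∫ s in Set.Ioc ε (ε + c₁), h (X s ω),
        ∫ s in Set.Ioc (t - ε - c₂) (t - ε), h (X s ω)) =
      ∫⁻ z, ENNReal.ofReal (gapDensity d ε η g t a b x y (W η z.1, W' η z.2)
          (W (η + c₁) z.1, W' (η + c₂) z.2)) *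
        G (∫ s in Set.Ioc η (η + c₁), h (W s z.1), ∫ s in Set.Ioc η (η + c₂), h (W' s z.2))
        ∂((ℙ : Measure Ω').prod ℙ) := by
  have hX1 := hX.aemeasurable_piece hε hc₁ hc₂ hg htot
  have hW1 := IsBrownianMotion.aemeasurable_piece hη hc₁ hc₂ hW hW'
  set Φ : (Set.Icc (0 : ℚ) 1 → Euc d × Euc d) → ENNReal := fun p =>
    G (c₁ * pathFunctional (fun w => h w.1) p, c₂ * pathFunctional (fun w => h w.2) p) with hΦ
  have hΦm : Measurable Φ := hG.comp
    (((measurable_pathFunctional (hh.comp measurable_fst)).const_mul _).prodMk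
      ((measurable_pathFunctional (hh.comp measurable_snd)).const_mul _))
  have hDm : Measurable fun p : Set.Icc (0 : ℚ) 1 → Euc d × Euc d =>
      ENNReal.ofReal (gapDensity d ε η g t a b x y (p 0) (p 1)) := by
    have h1 : Measurable fun p : Set.Icc (0 : ℚ) 1 → Euc d × Euc d => (p 0, p 1) :=
      (measurable_pi_apply _).prodMk (measurable_pi_apply _)
    exact ((measurable_gapDensity ε η g t a b x y).comp h1).ennreal_ofReal
  have eX : ∀ ω, G (∫ s in Set.Ioc ε (ε + c₁), h (X s ω),
      ∫ s in Set.Ioc (t - ε - c₂) (t - ε), h (X s ω)) =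
      Φ (fun q => (X (ε + c₁ * (q : ℚ)) ω, X (t - ε - c₂ * (q : ℚ)) ω)) := by
    intro ω
    have hc : ContinuousOn (fun s => (X (ε + c₁ * s) ω, X (t - ε - c₂ * s) ω))
        (Set.Icc 0 1) := by
      refine ((hX.2.2.1 ω).comp (by fun_prop) fun s hs => ?_).prodMk
        ((hX.2.2.1 ω).comp (by fun_prop) fun s hs => ?_)
      · exact (add_mul_mem_of_mem hε hc₁ hc₂ hg htot hs).1
      · exact (add_mul_mem_of_mem hε hc₁ hc₂ hg htot hs).2
    rw [integral_Ioc_add_mul _ _ hc₁, integral_Ioc_sub_mul _ _ hc₂, hΦ]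
    simp only
    rw [pathFunctional_eq (fun w : Euc d × Euc d => h w.1) hc,
      pathFunctional_eq (fun w : Euc d × Euc d => h w.2) hc]
  have eW : ∀ z : Ω' × Ω', G (∫ s in Set.Ioc η (η + c₁), h (W s z.1),
      ∫ s in Set.Ioc η (η + c₂), h (W' s z.2)) =
      Φ (fun q => (W (η + c₁ * (q : ℚ)) z.1, W' (η + c₂ * (q : ℚ)) z.2)) := by
    intro z
    have hc : ContinuousOn (fun s => (W (η + c₁ * s) z.1, W' (η + c₂ * s) z.2))
        (Set.Icc 0 1) :=
      (((hW.2.1 z.1).comp (by fun_prop)).prodMk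
        ((hW'.2.1 z.2).comp (by fun_prop))).continuousOn
    rw [integral_Ioc_add_mul _ _ hc₁, integral_Ioc_add_mul _ _ hc₂, hΦ]
    simp only
    rw [pathFunctional_eq (fun w : Euc d × Euc d => h w.1) hc,
      pathFunctional_eq (fun w : Euc d × Euc d => h w.2) hc]
  simp only [eX, eW]
  rw [← lintegral_map' hΦm.aemeasurable hX1, bridge_path_law hε hη hc₁ hc₂ hg htot hX hW hW',
    lintegral_withDensity_eq_lintegral_mul _ hDm hΦm,
    lintegral_map' (hDm.mul hΦm).aemeasurable hW1]
  refine lintegral_congr fun z => ?_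
  simp
end

end

section

section
variable {d : ℕ} {Ω : Type*} [MeasureSpace Ω]

/-- On the time set `S`, the process `Y` is almost surely equal to a jointly measurable one. -/
def HasMeasurableVersion (Y : ℝ → Ω → Euc d) (S : Set ℝ) : Prop :=
  ∃ P : Ω × ℝ → Euc d, Measurable P ∧ ∀ᵐ ω, ∀ s ∈ S, Y s ω = P (ω, s)

lemma IsBrownianMotion.hasMeasurableVersion {x : Euc d} {W : ℝ → Ω → Euc d}
    (hW : IsBrownianMotion x W) : HasMeasurableVersion W (Set.Ici 0) := by
  obtain ⟨P, hP, h⟩ := exists_measurable_modification (μ := (ℙ : Measure Ω))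
    (P := fun s => W (max s 0)) (fun ω => (hW.2.1 ω).comp (by fun_prop))
    (fun s => hW.aemeasurable (le_max_right _ _))
  refine ⟨P, hP, ?_⟩
  filter_upwards [h] with ω hω s hs
  rw [← hω s, max_eq_left hs]

lemma IsBrownianBridge.hasMeasurableVersion {a b : Euc d} {t : ℝ} (ht : 0 < t)
    {X : ℝ → Ω → Euc d} (hX : IsBrownianBridge t a b X) :
    HasMeasurableVersion X (Set.Icc 0 t) := by
  have hmem : ∀ s : ℝ, max 0 (min s t) ∈ Set.Icc 0 t := fun s =>
    ⟨le_max_left _ _, max_le ht.le (min_le_right _ _)⟩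
  obtain ⟨P, hP, h⟩ := exists_measurable_modification (μ := (ℙ : Measure Ω))
    (P := fun s => X (max 0 (min s t))) (fun ω => (hX.2.2.1 ω).comp_continuous (by fun_prop) hmem)
    (fun s => hX.aemeasurable ht (hmem s).1 (hmem s).2)
  refine ⟨P, hP, ?_⟩
  filter_upwards [h] with ω hω s hs
  rw [← hω s, min_eq_left hs.2, max_eq_right hs.1]

namespace HasMeasurableVersion
variable {Y : ℝ → Ω → Euc d} {S S' : Set ℝ}

lemma aemeasurable_setIntegral (hY : HasMeasurableVersion Y S) (hS' : MeasurableSet S')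
    (hS : S' ⊆ S) {h : Euc d → ℝ} (hh : Measurable h) :
    AEMeasurable (fun ω => ∫ s in S', h (Y s ω)) ℙ := by
  obtain ⟨P, hP, hYP⟩ := hY
  have h1 : Measurable fun ω => ∫ s in S', h (P (ω, s)) :=
    ((hh.comp hP).stronglyMeasurable.integral_prod_right' (ν := volume.restrict S')).measurable
  refine h1.aemeasurable.congr ?_
  filter_upwards [hYP] with ω hω
  exact setIntegral_congr_fun hS' fun s hs => by simp only [hω s (hS hs)]

lemma aemeasurable_setLIntegral (hY : HasMeasurableVersion Y S) (hS' : MeasurableSet S')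
    (hS : S' ⊆ S) {h : Euc d → ENNReal} (hh : Measurable h) :
    AEMeasurable (fun ω => ∫⁻ s in S', h (Y s ω)) ℙ := by
  obtain ⟨P, hP, hYP⟩ := hY
  have h1 : Measurable fun ω => ∫⁻ s in S', h (P (ω, s)) :=
    (hh.comp hP).lintegral_prod_right' (ν := volume.restrict S')
  refine h1.aemeasurable.congr ?_
  filter_upwards [hYP] with ω hω
  exact setLIntegral_congr_fun hS' fun s hs => by simp only [hω s (hS hs)]

lemma lintegral_swap [SFinite (ℙ : Measure Ω)] (hY : HasMeasurableVersion Y S)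
    (hS' : MeasurableSet S') (hS : S' ⊆ S) {h : Euc d → ENNReal} (hh : Measurable h) :
    ∫⁻ ω, ∫⁻ s in S', h (Y s ω) = ∫⁻ s in S', ∫⁻ ω, h (Y s ω) := by
  obtain ⟨P, hP, hYP⟩ := hY
  have e1 : ∫⁻ ω, ∫⁻ s in S', h (Y s ω) = ∫⁻ ω, ∫⁻ s in S', h (P (ω, s)) := by
    refine lintegral_congr_ae ?_
    filter_upwards [hYP] with ω hω
    exact setLIntegral_congr_fun hS' fun s hs => by simp only [hω s (hS hs)]
  have e2 : ∫⁻ s in S', ∫⁻ ω, h (Y s ω) = ∫⁻ s in S', ∫⁻ ω, h (P (ω, s)) := by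
    refine setLIntegral_congr_fun hS' fun s hs => lintegral_congr_ae ?_
    filter_upwards [hYP] with ω hω
    rw [hω s (hS hs)]
  rw [e1, e2]
  exact lintegral_lintegral_swap (hh.comp hP).aemeasurable

end HasMeasurableVersion

lemma lintegral_of_map_fin_one {Y : Ω → Euc d} {ρ : Euc d → ℝ} (hρ : Measurable ρ)
    (hY : AEMeasurable Y ℙ)
    (h : Measure.map (fun ω (_ : Fin 1) => Y ω) ℙ =
      (volume : Measure (Fin 1 → Euc d)).withDensity fun z => ENNReal.ofReal (ρ (z 0)))
    {f : Euc d → ENNReal} (hf : Measurable f) :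
    ∫⁻ ω, f (Y ω) = ∫⁻ z, ENNReal.ofReal (ρ z) * f z := by
  have hY' : AEMeasurable (fun ω (_ : Fin 1) => Y ω) ℙ := aemeasurable_pi_iff.2 fun _ => hY
  have hf' : Measurable fun z : Fin 1 → Euc d => f (z 0) := hf.comp (measurable_pi_apply 0)
  have hρ' : Measurable fun z : Fin 1 → Euc d => ENNReal.ofReal (ρ (z 0)) :=
    (hρ.comp (measurable_pi_apply 0)).ennreal_ofReal
  rw [← lintegral_map' (f := fun z : Fin 1 → Euc d => f (z 0)) hf'.aemeasurable hY', h,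
    lintegral_withDensity_eq_lintegral_mul _ hρ' hf',
    ← (volume_preserving_funUnique (Fin 1) (Euc d)).lintegral_comp
      (f := fun z => ENNReal.ofReal (ρ z) * f z) (hρ.ennreal_ofReal.mul hf)]
  rfl

lemma IsBrownianMotion.lintegral_eq {x : Euc d} {W : ℝ → Ω → Euc d} (hW : IsBrownianMotion x W)
    {s : ℝ} (hs : 0 < s) {f : Euc d → ENNReal} (hf : Measurable f) :
    ∫⁻ ω, f (W s ω) = ∫⁻ z, ENNReal.ofReal (heatKernel d s (z - x)) * f z := by
  have hρ : Measurable fun z : Euc d => heatKernel d s (z - x) := by fun_prop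
  refine lintegral_of_map_fin_one hρ (hW.aemeasurable hs.le) ?_ hf
  have h := hW.2.2 0 (fun _ => s) (fun i j hij => absurd hij (by simp)) fun _ => hs
  convert h using 3
  simp [jointDensity]

lemma IsBrownianBridge.lintegral_eq {a b : Euc d} {t : ℝ} {X : ℝ → Ω → Euc d}
    (hX : IsBrownianBridge t a b X) {s : ℝ} (hs : 0 < s) (hst : s < t) {f : Euc d → ENNReal}
    (hf : Measurable f) :
    ∫⁻ ω, f (X s ω) = ∫⁻ z, ENNReal.ofReal (heatKernel d s (z - a) * heatKernel d (t - s) (b - z) /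
      heatKernel d t (b - a)) * f z := by
  have hρ : Measurable fun z : Euc d => heatKernel d s (z - a) * heatKernel d (t - s) (b - z) /
      heatKernel d t (b - a) := by fun_prop
  refine lintegral_of_map_fin_one hρ (hX.aemeasurable (hs.trans hst) hs.le hst.le) ?_ hf
  have h := hX.2.2.2 0 (fun _ => s) (fun i j hij => absurd hij (by simp)) fun _ => ⟨hs, hst⟩
  convert h using 3 with z
  have e0 : (Fin.snoc (fun _ : Fin 1 => s) t : Fin 2 → ℝ) = ![s, t] := by
    ext i; fin_cases i <;> rfl
  have e1 : (Fin.snoc z b : Fin 2 → Euc d) = ![z 0, b] := by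
    ext i; fin_cases i <;> rfl
  simp only [bridgeDensity, e0, e1]
  simp [jointDensity, Fin.prod_univ_two]
end

end

section

section

lemma lintegral_Ici_rpow {r : ℝ} (hr : r < -1) {T : ℝ} (hT : 0 < T) :
    ∫⁻ s in Set.Ici T, ENNReal.ofReal (s ^ r) = ENNReal.ofReal (-T ^ (r + 1) / (r + 1)) := by
  rw [setLIntegral_congr Ioi_ae_eq_Ici.symm, ← integral_Ioi_rpow_of_lt hr hT,
    ofReal_integral_eq_lintegral_ofReal (integrableOn_Ioi_rpow_of_lt hr hT)]
  filter_upwards [ae_restrict_mem measurableSet_Ioi] with s hs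
  exact rpow_nonneg (hT.trans hs).le _

lemma tendsto_lintegral_Ici_rpow {r : ℝ} (hr : r < -1) :
    Tendsto (fun T : ℝ => ∫⁻ s in Set.Ici T, ENNReal.ofReal (s ^ r)) atTop (𝓝 0) := by
  have h1 : Tendsto (fun T : ℝ => -T ^ (r + 1) / (r + 1)) atTop (𝓝 0) := by
    have h := tendsto_rpow_neg_atTop (y := -(r + 1)) (by linarith)
    simpa using (h.neg.div_const (r + 1))
  have h2 := ENNReal.tendsto_ofReal h1
  rw [ENNReal.ofReal_zero] at h2
  refine h2.congr' ?_
  filter_upwards [eventually_gt_atTop 0] with T hT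
  exact (lintegral_Ici_rpow hr hT).symm

variable {d : ℕ} {Ω : Type*} [MeasureSpace Ω]

lemma heatKernel_le_rpow {s : ℝ} (hs : 0 < s) (w : Euc d) :
    heatKernel d s w ≤ s ^ (-(d : ℝ) / 2) := by
  refine (heatKernel_le hs w).trans ?_
  rw [neg_div]
  refine rpow_le_rpow_of_nonpos hs ?_ (neg_nonpos.2 (by positivity))
  nlinarith [Real.pi_gt_three]

lemma heatKernel_sub_le {s t : ℝ} (hs : 0 < s) (hst : s ≤ t / 2) (w : Euc d) :
    heatKernel d (t - s) w ≤ 2 ^ ((d : ℝ) / 2) * (2 * π * t) ^ (-(d : ℝ) / 2) := by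
  have ht : 0 < t := by linarith
  refine (heatKernel_le (by linarith) w).trans ?_
  have h1 : (2 * π * (t - s)) ^ (-(d : ℝ) / 2) ≤ (2⁻¹ * (2 * π * t)) ^ (-(d : ℝ) / 2) := by
    rw [neg_div]
    refine rpow_le_rpow_of_nonpos (by positivity) ?_ (neg_nonpos.2 (by positivity))
    nlinarith [Real.pi_pos]
  refine h1.trans_eq ?_
  rw [mul_rpow (by norm_num) (by positivity), inv_rpow (by norm_num), neg_div,
    rpow_neg (by norm_num) ((d : ℝ) / 2), inv_inv]

lemma bridge_marginal_le_of_le_half {s t : ℝ} (hs : 0 < s) (hst : s ≤ t / 2) (w₁ w₂ w : Euc d) :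
    heatKernel d s w₁ * heatKernel d (t - s) w₂ / heatKernel d t w ≤
      2 ^ ((d : ℝ) / 2) * rexp (‖w‖ ^ 2 / (2 * t)) * s ^ (-(d : ℝ) / 2) := by
  have ht : 0 < t := by linarith
  rw [div_le_iff₀ (heatKernel_pos ht w)]
  have h1 : rexp (‖w‖ ^ 2 / (2 * t)) * heatKernel d t w = (2 * π * t) ^ (-(d : ℝ) / 2) := by
    unfold heatKernel
    rw [mul_left_comm, ← Real.exp_add]
    simp [neg_div]
  calc heatKernel d s w₁ * heatKernel d (t - s) w₂
      ≤ s ^ (-(d : ℝ) / 2) * (2 ^ ((d : ℝ) / 2) * (2 * π * t) ^ (-(d : ℝ) / 2)) :=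
        mul_le_mul (heatKernel_le_rpow hs _) (heatKernel_sub_le hs hst _)
          (heatKernel_pos (by linarith) _).le (by positivity)
    _ = _ := by rw [← h1]; ring

lemma bridge_marginal_le {s t : ℝ} (hs : 0 < s) (hst : s < t) (w₁ w₂ w : Euc d) :
    heatKernel d s w₁ * heatKernel d (t - s) w₂ / heatKernel d t w ≤
      2 ^ ((d : ℝ) / 2) * rexp (‖w‖ ^ 2 / (2 * t)) *
        (s ^ (-(d : ℝ) / 2) + (t - s) ^ (-(d : ℝ) / 2)) := by
  have h1 : 0 < s ^ (-(d : ℝ) / 2) := by positivity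
  have h2 : 0 < (t - s) ^ (-(d : ℝ) / 2) := rpow_pos_of_pos (by linarith) _
  rcases le_total s (t / 2) with h | h
  · refine (bridge_marginal_le_of_le_half hs h w₁ w₂ w).trans ?_
    gcongr
    linarith
  · have := bridge_marginal_le_of_le_half (t := t) (s := t - s) (by linarith) (by linarith) w₂ w₁ w
    rw [sub_sub_cancel, mul_comm (heatKernel d (t - s) w₂)] at this
    refine this.trans ?_
    gcongr
    linarith

lemma lintegral_Ioc_rpow_add_le (r T t : ℝ) :
    ∫⁻ s in Set.Ioc T (t - T), ENNReal.ofReal (s ^ r + (t - s) ^ r) ≤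
      2 * ∫⁻ s in Set.Ici T, ENNReal.ofReal (s ^ r) := by
  have hm : Measurable fun s : ℝ => ENNReal.ofReal (s ^ r) := by fun_prop
  have hpre : (fun s : ℝ => t - s) ⁻¹' Set.Ici T = Set.Iic (t - T) := by
    ext s; simp [le_sub_comm]
  calc ∫⁻ s in Set.Ioc T (t - T), ENNReal.ofReal (s ^ r + (t - s) ^ r)
      ≤ ∫⁻ s in Set.Ioc T (t - T), (ENNReal.ofReal (s ^ r) + ENNReal.ofReal ((t - s) ^ r)) :=
        lintegral_mono fun s => ENNReal.ofReal_add_le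
    _ = (∫⁻ s in Set.Ioc T (t - T), ENNReal.ofReal (s ^ r)) +
        ∫⁻ s in Set.Ioc T (t - T), ENNReal.ofReal ((t - s) ^ r) := lintegral_add_left hm _
    _ ≤ (∫⁻ s in Set.Ici T, ENNReal.ofReal (s ^ r)) +
        ∫⁻ s in Set.Iic (t - T), ENNReal.ofReal ((t - s) ^ r) := by
        gcongr
        · exact fun s hs => hs.1.le
        · exact fun s hs => hs.2
    _ = 2 * ∫⁻ s in Set.Ici T, ENNReal.ofReal (s ^ r) := by
        have h := (Measure.measurePreserving_sub_left volume t).setLIntegral_comp_preimage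
          (measurableSet_Ici (a := T)) hm
        rw [hpre] at h
        rw [h, two_mul]

/-- The expected absolute path integral of a bridge over the middle times. -/
lemma IsBrownianBridge.lintegral_middle_le [SFinite (ℙ : Measure Ω)] {a b : Euc d} {t : ℝ}
    (ht : 0 < t) {X : ℝ → Ω → Euc d} (hX : IsBrownianBridge t a b X) {v : Euc d → ℝ}
    (hv : Measurable v) {T : ℝ} (hT : 0 < T) :
    ∫⁻ ω, ∫⁻ s in Set.Ioc T (t - T), ‖v (X s ω)‖ₑ ≤
      ENNReal.ofReal (2 ^ ((d : ℝ) / 2) * rexp (‖b - a‖ ^ 2 / (2 * t))) * (∫⁻ z, ‖v z‖ₑ) *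
        (2 * ∫⁻ s in Set.Ici T, ENNReal.ofReal (s ^ (-(d : ℝ) / 2))) := by
  rw [(hX.hasMeasurableVersion ht).lintegral_swap measurableSet_Ioc
    (fun s hs => ⟨(hT.trans hs.1).le, by linarith [hs.2]⟩) (h := fun z => ‖v z‖ₑ) hv.enorm]
  set A := 2 ^ ((d : ℝ) / 2) * rexp (‖b - a‖ ^ 2 / (2 * t)) with hA
  have hA0 : 0 ≤ A := by positivity
  have h1 : ∀ s ∈ Set.Ioc T (t - T), ∫⁻ ω, ‖v (X s ω)‖ₑ ≤
      ENNReal.ofReal A * (∫⁻ z, ‖v z‖ₑ) *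
        ENNReal.ofReal (s ^ (-(d : ℝ) / 2) + (t - s) ^ (-(d : ℝ) / 2)) := by
    intro s hs
    have hs0 : 0 < s := hT.trans hs.1
    have hst : s < t := by linarith [hs.2]
    rw [hX.lintegral_eq hs0 hst (f := fun z => ‖v z‖ₑ) hv.enorm, mul_right_comm,
      ← ENNReal.ofReal_mul hA0, ← lintegral_const_mul _ hv.enorm]
    refine lintegral_mono fun z => ?_
    gcongr
    exact bridge_marginal_le hs0 hst _ _ _
  refine (setLIntegral_mono' measurableSet_Ioc h1).trans ?_
  have hm : Measurable fun s : ℝ =>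
      ENNReal.ofReal (s ^ (-(d : ℝ) / 2) + (t - s) ^ (-(d : ℝ) / 2)) := by
    fun_prop
  rw [lintegral_const_mul _ hm]
  gcongr
  exact lintegral_Ioc_rpow_add_le _ _ _

/-- In dimension at least three a bounded integrable function is almost surely integrable along
Brownian paths. -/
lemma IsBrownianMotion.ae_integrableOn [IsFiniteMeasure (ℙ : Measure Ω)] (hd : 3 ≤ d) {x : Euc d}
    {W : ℝ → Ω → Euc d} (hW : IsBrownianMotion x W) {v : Euc d → ℝ} (hv : Measurable v)
    {C : ℝ} (hC : ∀ z, |v z| ≤ C) (hL : ∫⁻ z, ‖v z‖ₑ ≠ ⊤) :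
    ∀ᵐ ω, IntegrableOn (fun s => v (W s ω)) (Set.Ioi 0) := by
  have hr : -(d : ℝ) / 2 < -1 := by
    have : (3 : ℝ) ≤ d := by exact_mod_cast hd
    linarith
  have hfin : ∫⁻ ω, ∫⁻ s in Set.Ici (1 : ℝ), ‖v (W s ω)‖ₑ ≠ ⊤ := by
    rw [hW.hasMeasurableVersion.lintegral_swap measurableSet_Ici
      (Set.Ici_subset_Ici.2 zero_le_one) (h := fun z => ‖v z‖ₑ) hv.enorm]
    have h1 : ∀ s ∈ Set.Ici (1 : ℝ), ∫⁻ ω, ‖v (W s ω)‖ₑ ≤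
        (∫⁻ z, ‖v z‖ₑ) * ENNReal.ofReal (s ^ (-(d : ℝ) / 2)) := by
      intro s hs
      have hs0 : 0 < s := zero_lt_one.trans_le hs
      rw [hW.lintegral_eq hs0 (f := fun z => ‖v z‖ₑ) hv.enorm, mul_comm,
        ← lintegral_const_mul _ hv.enorm]
      refine lintegral_mono fun z => ?_
      gcongr
      exact heatKernel_le_rpow hs0 _
    refine ne_top_of_le_ne_top ?_ (setLIntegral_mono' measurableSet_Ici h1)
    rw [lintegral_const_mul _ (by fun_prop), lintegral_Ici_rpow hr one_pos]
    exact ENNReal.mul_ne_top hL ENNReal.ofReal_ne_top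
  have hm : AEMeasurable (fun ω => ∫⁻ s in Set.Ici (1 : ℝ), ‖v (W s ω)‖ₑ) ℙ :=
    hW.hasMeasurableVersion.aemeasurable_setLIntegral measurableSet_Ici
      (Set.Ici_subset_Ici.2 zero_le_one) (h := fun z => ‖v z‖ₑ) hv.enorm
  filter_upwards [ae_lt_top' hm hfin] with ω hω
  have hmeas : Measurable fun s => v (W s ω) := hv.comp (hW.2.1 ω).measurable
  have h1 : IntegrableOn (fun s => v (W s ω)) (Set.Ici 1) := ⟨hmeas.aestronglyMeasurable, hω⟩
  have h2 : IntegrableOn (fun s => v (W s ω)) (Set.Ioc 0 1) :=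
    Measure.integrableOn_of_bounded (M := C) (by simp) hmeas.aestronglyMeasurable
      (ae_of_all _ fun s => by simpa using hC _)
  refine (h2.union h1).mono_set fun s hs => ?_
  rcases le_total s 1 with h | h
  · exact Or.inl ⟨hs, h⟩
  · exact Or.inr h
end

end

section

section
variable {d : ℕ}

lemma heatKernel_one_div_two_le (z a x : Euc d) :
    heatKernel d 1 (z - a) / heatKernel d 2 (z - x) ≤
      2 ^ ((d : ℝ) / 2) * rexp (‖a - x‖ ^ 2 / 2) := by
  rw [div_le_iff₀ (heatKernel_pos two_pos _)]
  have h0 : ‖z - x‖ ≤ ‖z - a‖ + ‖a - x‖ := norm_sub_le_norm_sub_add_norm_sub _ _ _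
  have h1 : ‖z - x‖ ^ 2 ≤ 2 * ‖z - a‖ ^ 2 + 2 * ‖a - x‖ ^ 2 := by
    nlinarith [sq_nonneg (‖z - a‖ - ‖a - x‖), norm_nonneg (z - x)]
  have h2 : (2 : ℝ) ^ ((d : ℝ) / 2) * (2 * π * 2) ^ (-(d : ℝ) / 2) = (2 * π) ^ (-(d : ℝ) / 2) := by
    rw [mul_rpow (by positivity) two_pos.le, mul_left_comm, ← rpow_add two_pos]
    simp [neg_div]
  unfold heatKernel
  calc (2 * π * 1) ^ (-(d : ℝ) / 2) * rexp (-‖z - a‖ ^ 2 / (2 * 1))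
      ≤ (2 * π) ^ (-(d : ℝ) / 2) *
        rexp (‖a - x‖ ^ 2 / 2 + -‖z - x‖ ^ 2 / (2 * 2)) := by
        rw [mul_one]
        gcongr
        linarith
    _ = _ := by rw [← h2, Real.exp_add]; ring

lemma heatKernel_div_le {t k : ℝ} (ht : 1 ≤ t) (hk : 0 < k) (w₁ w : Euc d) :
    heatKernel d (t / k) w₁ / heatKernel d t w ≤ k ^ ((d : ℝ) / 2) * rexp (‖w‖ ^ 2 / 2) := by
  have ht0 : 0 < t := by linarith
  rw [div_le_iff₀ (heatKernel_pos ht0 _)]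
  refine (heatKernel_le (by positivity) w₁).trans ?_
  have h1 : (2 * π * (t / k)) ^ (-(d : ℝ) / 2) =
      k ^ ((d : ℝ) / 2) * (2 * π * t) ^ (-(d : ℝ) / 2) := by
    rw [← mul_div_assoc, div_rpow (by positivity) hk.le, neg_div, rpow_neg hk.le, div_inv_eq_mul,
      mul_comm]
  have h2 : 1 ≤ rexp (‖w‖ ^ 2 / 2) * rexp (-‖w‖ ^ 2 / (2 * t)) := by
    rw [← Real.exp_add, Real.one_le_exp_iff, neg_div, ← sub_eq_add_neg, sub_nonneg]
    gcongr
    linarith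
  rw [h1]
  unfold heatKernel
  have h3 : 0 ≤ k ^ ((d : ℝ) / 2) * (2 * π * t) ^ (-(d : ℝ) / 2) := by positivity
  nlinarith [mul_le_mul_of_nonneg_left h2 h3]

/-- A bound for `gapDensity`. -/
def gapBound (d : ℕ) (k : ℝ) (x y a b : Euc d) : ℝ :=
  2 ^ ((d : ℝ) / 2) * rexp (‖a - x‖ ^ 2 / 2) * (2 ^ ((d : ℝ) / 2) * rexp (‖b - y‖ ^ 2 / 2)) *
    (k ^ ((d : ℝ) / 2) * rexp (‖b - a‖ ^ 2 / 2))

lemma gapDensity_le {t k : ℝ} (ht : 1 ≤ t) (hk : 0 < k) (a b x y : Euc d)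
    (p₀ p₁ : Euc d × Euc d) :
    gapDensity d 1 2 (t / k) t a b x y p₀ p₁ ≤ gapBound d k x y a b := by
  have ht0 : 0 < t := by linarith
  have h1 := heatKernel_pos one_pos (p₀.2 - b)
  have h2 := heatKernel_pos two_pos (p₀.2 - y)
  have h3 := heatKernel_pos (show 0 < t / k by positivity) (p₁.2 - p₁.1)
  have h4 := heatKernel_pos ht0 (b - a)
  unfold gapDensity gapBound
  gcongr
  · exact heatKernel_one_div_two_le _ _ _
  · exact heatKernel_one_div_two_le _ _ _
  · exact heatKernel_div_le ht hk _ _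

/-- Some block among `n` equal blocks can be removed at the cost of a factor `1 - 1/n`. -/
lemma exists_small_block {f : ℝ → ℝ} {C t : ℝ} {n : ℕ} (hn : 0 < n) (ht : (n : ℝ) + 2 < t)
    (hf0 : ∀ s, 0 ≤ f s) (hfC : ∀ s, f s ≤ C) (hf : IntegrableOn f (Set.Ioc 0 t)) :
    ∃ i ∈ Finset.range n, (1 - 1 / (n : ℝ)) * ∫ s in Set.Ioc 0 t, f s ≤
      2 * C + ((∫ s in Set.Ioc 1 ((i + 1) * (t / (n + 2))), f s) +
        ∫ s in Set.Ioc ((i + 2) * (t / (n + 2))) (t - 1), f s) := by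
  have hn0 : (0 : ℝ) < n := by exact_mod_cast hn
  set D := t / ((n : ℝ) + 2) with hD
  have hD1 : 1 < D := by rw [hD, one_lt_div (by positivity)]; exact ht
  have htD : t = (n + 2) * D := by rw [hD]; field_simp
  have hint : IntervalIntegrable f volume 0 t :=
    (intervalIntegrable_iff_integrableOn_Ioc_of_le (by linarith)).2 hf
  have hI : ∀ {u w : ℝ}, 0 ≤ u → u ≤ t → 0 ≤ w → w ≤ t → IntervalIntegrable f volume u w :=
    fun h1 h2 h3 h4 => hint.mono_set (by
      rw [Set.uIcc_of_le (show (0 : ℝ) ≤ t by linarith)]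
      exact Set.uIcc_subset_Icc ⟨h1, h2⟩ ⟨h3, h4⟩)
  set F : ℝ → ℝ := fun u => ∫ s in (0 : ℝ)..u, f s with hF
  have hsub : ∀ {u w : ℝ}, 0 ≤ u → u ≤ w → w ≤ t → ∫ s in Set.Ioc u w, f s = F w - F u := by
    intro u w h1 h2 h3
    rw [← intervalIntegral.integral_of_le h2, hF]
    exact (intervalIntegral.integral_interval_sub_left (hI le_rfl (by linarith) (by linarith) h3)
      (hI le_rfl (by linarith) h1 (by linarith))).symm
  have hmono : ∀ {u w : ℝ}, 0 ≤ u → u ≤ w → w ≤ t → F u ≤ F w := by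
    intro u w h1 h2 h3
    have := hsub h1 h2 h3
    have h4 : 0 ≤ ∫ s in Set.Ioc u w, f s := integral_nonneg hf0
    linarith
  have hlip : ∀ {u : ℝ}, 0 ≤ u → u + 1 ≤ t → F (u + 1) - F u ≤ C := by
    intro u h1 h2
    rw [← hsub h1 (by linarith) h2]
    have h := setIntegral_mono_on (hf.mono_set (Set.Ioc_subset_Ioc h1 h2))
      (integrableOn_const (C := C) (by simp)) measurableSet_Ioc (fun s _ => hfC s)
    simpa using h
  have hF0 : F 0 = 0 := by simp [hF]
  have hV : ∫ s in Set.Ioc 0 t, f s = F t := by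
    rw [hsub le_rfl (by linarith) le_rfl, hF0, sub_zero]
  have hsum : ∑ i ∈ Finset.range n, (F ((i + 2) * D) - F ((i + 1) * D)) ≤
      ∑ i ∈ Finset.range n, F t / n := by
    have h := Finset.sum_range_sub (fun i : ℕ => F (((i : ℝ) + 1) * D)) n
    have e : ∀ i : ℕ, ((i + 1 : ℕ) : ℝ) + 1 = (i : ℝ) + 2 := fun i => by push_cast; ring
    simp only [e, Nat.cast_zero, zero_add, one_mul] at h
    rw [h, Finset.sum_const, Finset.card_range, nsmul_eq_mul, mul_div_cancel₀ _ hn0.ne']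
    have h1 : F ((n + 1) * D) ≤ F t := hmono (by positivity) (by rw [htD]; nlinarith) le_rfl
    have h2 : F 0 ≤ F D := hmono le_rfl (by linarith) (by rw [htD]; nlinarith)
    linarith
  obtain ⟨i, hi, hiF⟩ := Finset.exists_le_of_sum_le (Finset.nonempty_range_iff.2 hn.ne') hsum
  refine ⟨i, hi, ?_⟩
  have hin : (i : ℝ) + 1 ≤ n := by exact_mod_cast Finset.mem_range.1 hi
  have hi0 : (0 : ℝ) ≤ i := Nat.cast_nonneg i
  have b1 : 1 ≤ (i + 1) * D := by nlinarith
  have b2 : ((i : ℝ) + 2) * D ≤ t - 1 := by rw [htD]; nlinarith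
  have b3 : ((i : ℝ) + 1) * D ≤ (i + 2) * D := by nlinarith
  rw [hV, hsub zero_le_one b1 (by linarith), hsub (by linarith) b2 (by linarith)]
  have c1 := hlip (u := 0) le_rfl (by linarith)
  have c2 := hlip (u := t - 1) (by linarith) (by linarith)
  rw [zero_add, hF0] at c1
  rw [sub_add_cancel] at c2
  have : (1 - 1 / (n : ℝ)) * F t = F t - F t / n := by ring
  rw [this]
  linarith
end

section
variable {d : ℕ} {Ω Ω' : Type*} [MeasureSpace Ω] [MeasureSpace Ω']

lemma IsBrownianBridge.aestronglyMeasurable_comp {a b : Euc d} {t : ℝ} {X : ℝ → Ω → Euc d}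
    (hX : IsBrownianBridge t a b X) {v : Euc d → ℝ} (hv : Measurable v) (ω : Ω) :
    AEStronglyMeasurable (fun s => v (X s ω)) (volume.restrict (Set.Icc 0 t)) :=
  (hv.comp_aemeasurable ((hX.2.2.1 ω).aemeasurable measurableSet_Icc)).aestronglyMeasurable

lemma IsBrownianBridge.integrableOn_comp {a b : Euc d} {t : ℝ} {X : ℝ → Ω → Euc d}
    (hX : IsBrownianBridge t a b X) {v : Euc d → ℝ} (hv : Measurable v) {C : ℝ}
    (hC : ∀ z, |v z| ≤ C) (ω : Ω) : IntegrableOn (fun s => v (X s ω)) (Set.Ioc 0 t) :=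
  IntegrableOn.mono_set (t := Set.Icc 0 t) (Integrable.of_bound
    (hX.aestronglyMeasurable_comp hv ω) C (ae_of_all _ fun _ => hC _)) Set.Ioc_subset_Icc_self

/-- The exponential moment of the total absolute path integral. -/
def totalMgf (v : Euc d → ℝ) (W : ℝ → Ω' → Euc d) (β : ℝ) : ENNReal :=
  ∫⁻ ω', ENNReal.ofReal (rexp (β * ∫ s in Set.Ioi (0 : ℝ), |v (W s ω')|))

lemma lintegral_outer_le [IsProbabilityMeasure (ℙ : Measure Ω)]
    [IsProbabilityMeasure (ℙ : Measure Ω')] (hd : 3 ≤ d) {v : Euc d → ℝ} (hv : Measurable v)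
    {C : ℝ} (hC : ∀ z, |v z| ≤ C) (hL : ∫⁻ z, ‖v z‖ₑ ≠ ⊤) {β : ℝ} (hβ : 0 ≤ β)
    {a b x y : Euc d} {c₁ c₂ k t : ℝ} (hc₁ : 0 < c₁) (hc₂ : 0 < c₂) (hk : 0 < k) (ht : 1 ≤ t)
    (htot : t = 1 + c₁ + t / k + c₂ + 1)
    {X : ℝ → Ω → Euc d} (hX : IsBrownianBridge t a b X)
    {W W' : ℝ → Ω' → Euc d} (hW : IsBrownianMotion x W) (hW' : IsBrownianMotion y W') :
    ∫⁻ ω, ENNReal.ofReal (rexp (β * ((∫ s in Set.Ioc 1 (1 + c₁), |v (X s ω)|) +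
        ∫ s in Set.Ioc (t - 1 - c₂) (t - 1), |v (X s ω)|))) ≤
      ENNReal.ofReal (gapBound d k x y a b) * (totalMgf v W β * totalMgf v W' β) := by
  have ht0 : 0 < t := by linarith
  have hG : Measurable fun p : ℝ × ℝ => ENNReal.ofReal (rexp (β * (p.1 + p.2))) := by fun_prop
  have habs : Measurable fun z => |v z| := hv.abs
  rw [bridge_lintegral one_pos two_pos hc₁ hc₂ (by positivity) htot hX hW hW' habs hG]
  have hm : ∀ {x : Euc d} {W : ℝ → Ω' → Euc d}, IsBrownianMotion x W →
      AEMeasurable (fun ω' => ENNReal.ofReal (rexp (β * ∫ s in Set.Ioi (0 : ℝ), |v (W s ω')|))) ℙ :=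
    fun hW => (((hW.hasMeasurableVersion.aemeasurable_setIntegral measurableSet_Ioi
      Set.Ioi_subset_Ici_self habs).const_mul β).exp).ennreal_ofReal
  have hle : ∀ {x : Euc d} {W : ℝ → Ω' → Euc d} (c : ℝ), IsBrownianMotion x W → ∀ᵐ ω',
      ∫ s in Set.Ioc 2 (2 + c), |v (W s ω')| ≤ ∫ s in Set.Ioi (0 : ℝ), |v (W s ω')| := by
    intro x W c hW
    filter_upwards [hW.ae_integrableOn hd hv hC hL] with ω' h
    refine setIntegral_mono_set h.abs (ae_of_all _ fun s => abs_nonneg _) ?_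
    exact LE.le.eventuallyLE fun s hs => zero_lt_two.trans hs.1
  unfold totalMgf
  rw [← lintegral_prod_mul (hm hW) (hm hW'), ← lintegral_const_mul' _ _
    ENNReal.ofReal_ne_top]
  refine lintegral_mono_ae ?_
  filter_upwards [Measure.quasiMeasurePreserving_fst.ae (hle c₁ hW),
    Measure.quasiMeasurePreserving_snd.ae (hle c₂ hW')] with z h1 h2
  rw [← ENNReal.ofReal_mul (p := rexp (β * ∫ s in Set.Ioi (0 : ℝ), |v (W s z.1)|))
    (Real.exp_nonneg _), ← Real.exp_add, ← mul_add]
  gcongr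
  exact gapDensity_le ht hk _ _ _ _ _ _

/-- A bound for exponential moments of the absolute path integral of a bridge. -/
lemma IsBrownianBridge.lintegral_exp_le [IsProbabilityMeasure (ℙ : Measure Ω)]
    [IsProbabilityMeasure (ℙ : Measure Ω')] (hd : 3 ≤ d) {v : Euc d → ℝ} (hv : Measurable v)
    {C : ℝ} (hC : ∀ z, |v z| ≤ C) (hL : ∫⁻ z, ‖v z‖ₑ ≠ ⊤) {β β' : ℝ} (hβ : 0 ≤ β) {n : ℕ}
    (hn : 0 < n) (hβ' : β' ≤ β * (1 - 1 / n)) {a b x y : Euc d} {t : ℝ} (ht : (n : ℝ) + 2 < t)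
    {X : ℝ → Ω → Euc d} (hX : IsBrownianBridge t a b X)
    {W W' : ℝ → Ω' → Euc d} (hW : IsBrownianMotion x W) (hW' : IsBrownianMotion y W') :
    ∫⁻ ω, ENNReal.ofReal (rexp (β' * ∫ s in Set.Ioc 0 t, |v (X s ω)|)) ≤
      n * (ENNReal.ofReal (rexp (β * (2 * C))) *
        (ENNReal.ofReal (gapBound d (n + 2) x y a b) * (totalMgf v W β * totalMgf v W' β))) := by
  have hn0 : (0 : ℝ) < n := by exact_mod_cast hn
  have ht0 : 0 < t := by linarith
  set D := t / ((n : ℝ) + 2) with hD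
  have hD1 : 1 < D := by rw [hD, one_lt_div (by positivity)]; exact ht
  have htD : t = (n + 2) * D := by rw [hD]; field_simp
  set I : ℕ → Ω → ℝ := fun i ω => (∫ s in Set.Ioc 1 ((i + 1) * D), |v (X s ω)|) +
    ∫ s in Set.Ioc ((i + 2) * D) (t - 1), |v (X s ω)| with hI
  have hb : ∀ i ∈ Finset.range n, 1 < ((i : ℝ) + 1) * D ∧ ((i : ℝ) + 1) * D < t ∧
      0 < ((i : ℝ) + 2) * D ∧ ((i : ℝ) + 2) * D < t - 1 := by
    intro i hi
    have hin : (i : ℝ) + 1 ≤ n := by exact_mod_cast Finset.mem_range.1 hi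
    have hi0 : (0 : ℝ) ≤ i := Nat.cast_nonneg i
    refine ⟨by nlinarith, by rw [htD]; nlinarith, by positivity, by rw [htD]; nlinarith⟩
  have hmeas : ∀ i ∈ Finset.range n,
      AEMeasurable (fun ω => ENNReal.ofReal (rexp (β * I i ω))) ℙ := by
    intro i hi
    obtain ⟨h1, h2, h3, h4⟩ := hb i hi
    have hv' := hX.hasMeasurableVersion ht0
    refine (((hv'.aemeasurable_setIntegral measurableSet_Ioc ?_ hv.abs).add
      (hv'.aemeasurable_setIntegral measurableSet_Ioc ?_ hv.abs)).const_mul β).exp.ennreal_ofReal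
    · exact fun s hs => ⟨by linarith [hs.1], by linarith [hs.2]⟩
    · exact fun s hs => ⟨by linarith [hs.1], by linarith [hs.2]⟩
  have hpt : ∀ ω, ENNReal.ofReal (rexp (β' * ∫ s in Set.Ioc 0 t, |v (X s ω)|)) ≤
      ∑ i ∈ Finset.range n, ENNReal.ofReal (rexp (β * (2 * C))) *
        ENNReal.ofReal (rexp (β * I i ω)) := by
    intro ω
    obtain ⟨i, hi, h⟩ := exists_small_block (f := fun s => |v (X s ω)|) hn ht
      (fun s => abs_nonneg _) (fun s => hC _) (hX.integrableOn_comp hv hC ω).abs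
    refine le_trans ?_ (Finset.single_le_sum (f := fun i => ENNReal.ofReal (rexp (β * (2 * C))) *
        ENNReal.ofReal (rexp (β * I i ω))) (fun _ _ => zero_le) hi)
    rw [← ENNReal.ofReal_mul (by positivity), ← Real.exp_add, ← mul_add]
    refine ENNReal.ofReal_le_ofReal (Real.exp_le_exp.2 ?_)
    have hV : 0 ≤ ∫ s in Set.Ioc 0 t, |v (X s ω)| := integral_nonneg fun s => abs_nonneg _
    calc β' * ∫ s in Set.Ioc 0 t, |v (X s ω)|
        ≤ β * (1 - 1 / n) * ∫ s in Set.Ioc 0 t, |v (X s ω)| := by gcongr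
      _ ≤ _ := by rw [mul_assoc]; exact mul_le_mul_of_nonneg_left h hβ
  refine (lintegral_mono hpt).trans ?_
  rw [lintegral_finsetSum' _ fun i hi => (hmeas i hi).const_mul _]
  refine (Finset.sum_le_card_nsmul _ _ _ fun i hi => ?_).trans_eq
    (by rw [Finset.card_range, nsmul_eq_mul])
  rw [lintegral_const_mul'' _ (hmeas i hi)]
  gcongr
  obtain ⟨h1, h2, h3, h4⟩ := hb i hi
  have key := lintegral_outer_le (c₁ := (i + 1) * D - 1) (c₂ := t - 1 - (i + 2) * D) (k := n + 2)
    hd hv hC hL hβ (by linarith) (by linarith) (by positivity) (by linarith)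
    (by rw [← hD]; ring) hX hW hW'
  rw [add_sub_cancel, sub_sub_cancel] at key
  exact key
end

end

section

/-- Scheffé's lemma: bounded functions integrate against probability densities converging to `1`. -/
lemma tendsto_integral_density_mul {Z ι : Type*} [MeasurableSpace Z] {μ : Measure Z}
    [IsProbabilityMeasure μ] {l : Filter ι} [l.IsCountablyGenerated] {Δ : ι → Z → ℝ} {g : Z → ℝ}
    (hΔ : ∀ᶠ t in l, Integrable (Δ t) μ ∧ ∫ z, Δ t z ∂μ = 1)
    (hlim : ∀ z, Tendsto (fun t => Δ t z) l (𝓝 1)) (hΔ0 : ∀ᶠ t in l, ∀ z, 0 ≤ Δ t z)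
    (hg : AEStronglyMeasurable g μ) {M : ℝ} (hM : ∀ z, |g z| ≤ M) :
    Tendsto (fun t => ∫ z, Δ t z * g z ∂μ) l (𝓝 (∫ z, g z ∂μ)) := by
  have hgi : Integrable g μ := Integrable.of_bound hg M (ae_of_all _ hM)
  have h1 : Tendsto (fun t => ∫ z, min (Δ t z) 1 ∂μ) l (𝓝 (∫ _, (1 : ℝ) ∂μ)) := by
    refine tendsto_integral_filter_of_dominated_convergence (fun _ => 1) ?_ ?_
      (integrable_const _) (ae_of_all _ fun z => ?_)
    · filter_upwards [hΔ] with t ht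
      exact ht.1.1.inf aestronglyMeasurable_const
    · filter_upwards [hΔ0] with t ht
      refine ae_of_all _ fun z => ?_
      rw [Real.norm_eq_abs, abs_of_nonneg (le_min (ht z) zero_le_one)]
      exact min_le_right _ _
    · simpa using (hlim z).min (tendsto_const_nhds (x := (1 : ℝ)))
  have h2 : Tendsto (fun t => M * (2 - 2 * ∫ z, min (Δ t z) 1 ∂μ)) l (𝓝 0) := by
    have := ((h1.const_mul 2).const_sub 2).const_mul M
    simpa using this
  rw [tendsto_iff_norm_sub_tendsto_zero]
  refine squeeze_zero' (Eventually.of_forall fun _ => norm_nonneg _) ?_ h2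
  filter_upwards [hΔ] with t ⟨hi, h1⟩
  have hmin : Integrable (fun z => min (Δ t z) 1) μ := hi.inf (integrable_const _)
  have hmul : Integrable (fun z => Δ t z * g z) μ := hi.mul_bdd hg (ae_of_all _ hM)
  rw [← integral_sub hmul hgi]
  have h3 : ∫ z, M * (Δ t z + 1 - 2 * min (Δ t z) 1) ∂μ = M * (2 - 2 * ∫ z, min (Δ t z) 1 ∂μ) := by
    have hi1 : Integrable (fun z => Δ t z + 1) μ := hi.add (integrable_const _)
    rw [integral_const_mul, integral_sub hi1 (hmin.const_mul 2),
      integral_add hi (integrable_const _), integral_const_mul, h1]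
    simp
    norm_num
  rw [← h3]
  refine norm_integral_le_of_norm_le (((hi.add (integrable_const _)).sub
    (hmin.const_mul 2)).const_mul M) (ae_of_all _ fun z => ?_)
  have h4 : Δ t z + 1 - 2 * min (Δ t z) 1 = |Δ t z - 1| := by
    rcases le_total (Δ t z) 1 with h | h
    · rw [min_eq_left h, abs_of_nonpos (by linarith)]; ring
    · rw [min_eq_right h, abs_of_nonneg (by linarith)]; ring
  rw [h4, Real.norm_eq_abs, ← sub_one_mul, abs_mul, mul_comm]
  exact mul_le_mul_of_nonneg_right (hM z) (abs_nonneg _)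

section
variable {d : ℕ}

lemma tendsto_heatKernel_div {c : ℝ} {xf yf : ℝ → Euc d} {x y : Euc d}
    (hx : Tendsto xf atTop (𝓝 x)) (hy : Tendsto yf atTop (𝓝 y)) (w : Euc d) :
    Tendsto (fun t => heatKernel d (t - c) w / heatKernel d t (yf t - xf t)) atTop (𝓝 1) := by
  have h1 : Tendsto (fun t : ℝ => ((t - c) / t) ^ (-(d : ℝ) / 2)) atTop (𝓝 1) := by
    have h : Tendsto (fun t : ℝ => 1 - c / t) atTop (𝓝 1) := by
      simpa using (tendsto_const_nhds (x := c)).div_atTop tendsto_id |>.const_sub 1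
    have h' := h.rpow_const (p := -(d : ℝ) / 2) (Or.inl one_ne_zero)
    rw [one_rpow] at h'
    refine h'.congr' ?_
    filter_upwards [eventually_gt_atTop 0] with t ht
    rw [sub_div, div_self ht.ne']
  have h2 : Tendsto (fun t : ℝ => rexp (-‖w‖ ^ 2 / (2 * (t - c)))) atTop (𝓝 1) := by
    have h : Tendsto (fun t : ℝ => 2 * (t - c)) atTop atTop :=
      (tendsto_id.atTop_add (tendsto_const_nhds (x := -c))).const_mul_atTop two_pos
    simpa using ((tendsto_const_nhds (x := -‖w‖ ^ 2)).div_atTop h).rexp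
  have h3 : Tendsto (fun t : ℝ => rexp (-‖yf t - xf t‖ ^ 2 / (2 * t))) atTop (𝓝 1) := by
    have h : Tendsto (fun t : ℝ => 2 * t) atTop atTop := tendsto_id.const_mul_atTop two_pos
    simpa using (((hy.sub hx).norm.pow 2).neg.div_atTop h).rexp
  have h4 := (h1.mul h2).div h3 one_ne_zero
  rw [mul_one, div_one] at h4
  refine h4.congr' ?_
  filter_upwards [eventually_gt_atTop 0, eventually_gt_atTop c] with t ht htc
  simp only [Pi.div_apply]
  have hp : 0 < (2 * π * t) ^ (-(d : ℝ) / 2) := by positivity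
  have htc' : 0 < t - c := by linarith
  unfold heatKernel
  rw [div_rpow htc'.le ht.le, mul_rpow (by positivity) htc'.le, mul_rpow (by positivity) ht.le]
  field_simp

lemma tendsto_gapDensity {ε c : ℝ} (hε : 0 < ε) {xf yf : ℝ → Euc d} {x y : Euc d}
    (hx : Tendsto xf atTop (𝓝 x)) (hy : Tendsto yf atTop (𝓝 y)) (p₀ p₁ : Euc d × Euc d) :
    Tendsto (fun t => gapDensity d ε ε (t - c) t (xf t) (yf t) x y p₀ p₁) atTop (𝓝 1) := by
  have h : ∀ {f : ℝ → Euc d} {u : Euc d} (z : Euc d), Tendsto f atTop (𝓝 u) →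
      Tendsto (fun t => heatKernel d ε (z - f t) / heatKernel d ε (z - u)) atTop (𝓝 1) := by
    intro f u z hf
    have := (((continuous_heatKernel (d := d) ε).tendsto _).comp (hf.const_sub z)).div_const
      (heatKernel d ε (z - u))
    rwa [div_self (heatKernel_pos hε _).ne'] at this
  have := ((h p₀.1 hx).mul (h p₀.2 hy)).mul (tendsto_heatKernel_div (c := c) hx hy (p₁.2 - p₁.1))
  simpa [gapDensity] using this

lemma abs_setIntegral_Ioc_le {f : ℝ → ℝ} {C u w : ℝ} (hf : ∀ s, |f s| ≤ C) (huw : u ≤ w) :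
    |∫ s in Set.Ioc u w, f s| ≤ C * (w - u) := by
  have := norm_setIntegral_le_of_norm_le_const (μ := volume) (s := Set.Ioc u w) (f := f) (C := C)
    (by simp) (fun s _ => hf s)
  simpa [Measure.real, huw] using this
end

section
variable {d : ℕ} {Ω Ω' : Type*} [MeasureSpace Ω] [MeasureSpace Ω']

lemma aemeasurable_gapDensity [SFinite (ℙ : Measure Ω')] {x y : Euc d}
    {W W' : ℝ → Ω' → Euc d} (hW : IsBrownianMotion x W) (hW' : IsBrownianMotion y W')
    {s₀ s₁ : ℝ} (h₀ : 0 ≤ s₀) (h₁ : 0 ≤ s₁) (ε η g t : ℝ) (a b : Euc d) :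
    AEMeasurable (fun z : Ω' × Ω' => gapDensity d ε η g t a b x y (W s₀ z.1, W' s₀ z.2)
       (W s₁ z.1, W' s₁ z.2)) ((ℙ : Measure Ω').prod ℙ) := by
  have hp : ∀ s : ℝ, 0 ≤ s → AEMeasurable (fun z : Ω' × Ω' => (W s z.1, W' s z.2))
      ((ℙ : Measure Ω').prod ℙ) := fun s hs =>
    ((hW.aemeasurable hs).comp_quasiMeasurePreserving Measure.quasiMeasurePreserving_fst).prodMk
      ((hW'.aemeasurable hs).comp_quasiMeasurePreserving Measure.quasiMeasurePreserving_snd)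
  have h := (hp s₀ h₀).prodMk (hp s₁ h₁)
  have h2 := (measurable_gapDensity ε η g t a b x y).comp_aemeasurable h
  exact h2

/-- The exponential moments of the path integrals over the two outer pieces of a long bridge
factorize asymptotically. -/
lemma IsBrownianBridge.tendsto_integral_exp_outer [IsProbabilityMeasure (ℙ : Measure Ω)]
    [IsProbabilityMeasure (ℙ : Measure Ω')] {v : Euc d → ℝ} (hv : Measurable v)
    {C : ℝ} (hC : ∀ z, |v z| ≤ C) (α : ℝ) {ε T : ℝ} (hε : 0 < ε) (hεT : ε < T)
    {xf yf : ℝ → Euc d} {x y : Euc d} (hx : Tendsto xf atTop (𝓝 x)) (hy : Tendsto yf atTop (𝓝 y))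
    {X : ℝ → ℝ → Ω → Euc d} (hX : ∀ t : ℝ, 0 < t → IsBrownianBridge t (xf t) (yf t) (X t))
    {W W' : ℝ → Ω' → Euc d} (hW : IsBrownianMotion x W) (hW' : IsBrownianMotion y W') :
    Tendsto (fun t => ∫ ω, rexp (α * ((∫ s in Set.Ioc ε T, v (X t s ω)) +
        ∫ s in Set.Ioc (t - T) (t - ε), v (X t s ω)))) atTop
      (𝓝 ((∫ ω', rexp (α * ∫ s in Set.Ioc ε T, v (W s ω'))) *
        ∫ ω', rexp (α * ∫ s in Set.Ioc ε T, v (W' s ω')))) := by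
  have hT : 0 < T := hε.trans hεT
  set Δ : ℝ → Ω' × Ω' → ℝ := fun t z => gapDensity d ε ε (t - 2 * T) t (xf t) (yf t) x y
    (W ε z.1, W' ε z.2) (W T z.1, W' T z.2) with hΔdef
  set g : Ω' × Ω' → ℝ := fun z => rexp (α * ((∫ s in Set.Ioc ε T, v (W s z.1)) +
    ∫ s in Set.Ioc ε T, v (W' s z.2))) with hgdef
  have hΔm : ∀ t, AEMeasurable (Δ t) ((ℙ : Measure Ω').prod ℙ) := fun t =>
    aemeasurable_gapDensity hW hW' hε.le hT.le _ _ _ _ _ _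
  have hsub : Set.Ioc ε T ⊆ Set.Ici 0 := fun s hs => (hε.trans hs.1).le
  have hgm : AEMeasurable g ((ℙ : Measure Ω').prod ℙ) :=
    (((hW.hasMeasurableVersion.aemeasurable_setIntegral measurableSet_Ioc hsub hv).comp_fst.add
      (hW'.hasMeasurableVersion.aemeasurable_setIntegral
        measurableSet_Ioc hsub hv).comp_snd).const_mul α).exp
  have hM : ∀ z, |g z| ≤ rexp (|α| * (2 * (C * (T - ε)))) := by
    intro z
    rw [hgdef, abs_of_pos (Real.exp_pos _), Real.exp_le_exp]
    refine (le_abs_self _).trans ?_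
    rw [abs_mul]
    gcongr
    refine (abs_add_le _ _).trans ?_
    have h1 := abs_setIntegral_Ioc_le (fun s => hC (W s z.1)) hεT.le
    have h2 := abs_setIntegral_Ioc_le (fun s => hC (W' s z.2)) hεT.le
    linarith
  have hΔ0 : ∀ᶠ t in atTop, ∀ z, 0 ≤ Δ t z := by
    filter_upwards [eventually_gt_atTop (2 * T)] with t ht z
    exact gapDensity_nonneg hε hε (by linarith) (by linarith) _ _ _ _ _ _
  have key : ∀ {G : ℝ × ℝ → ENNReal}, Measurable G → ∀ t, 2 * T < t →
      ∫⁻ ω, G (∫ s in Set.Ioc ε T, v (X t s ω), ∫ s in Set.Ioc (t - T) (t - ε), v (X t s ω)) =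
      ∫⁻ z, ENNReal.ofReal (Δ t z) *
        G (∫ s in Set.Ioc ε T, v (W s z.1), ∫ s in Set.Ioc ε T, v (W' s z.2))
        ∂((ℙ : Measure Ω').prod ℙ) := by
    intro G hG t ht
    have h := bridge_lintegral (c₁ := T - ε) (c₂ := T - ε) (g := t - 2 * T) (t := t) hε hε
      (by linarith) (by linarith) (by linarith) (by ring) (hX t (by linarith)) hW hW' hv hG
    rwa [show t - ε - (T - ε) = t - T by ring, add_sub_cancel] at h
  have hΔ1 : ∀ᶠ t in atTop, Integrable (Δ t) ((ℙ : Measure Ω').prod ℙ) ∧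
      ∫ z, Δ t z ∂((ℙ : Measure Ω').prod ℙ) = 1 := by
    filter_upwards [hΔ0, eventually_gt_atTop (2 * T)] with t h0 ht
    have h := key (G := fun _ => 1) measurable_const t ht
    simp only [lintegral_const, measure_univ, mul_one] at h
    refine ⟨⟨(hΔm t).aestronglyMeasurable, ?_⟩, ?_⟩
    · rw [hasFiniteIntegral_iff_ofReal (ae_of_all _ h0), ← h]
      exact ENNReal.one_lt_top
    · rw [integral_eq_lintegral_of_nonneg_ae (ae_of_all _ h0) (hΔm t).aestronglyMeasurable, ← h]
      exact ENNReal.toReal_one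
  have hlim := tendsto_integral_density_mul hΔ1
    (fun z => tendsto_gapDensity hε hx hy _ _) hΔ0 hgm.aestronglyMeasurable hM
  have hprod : ∫ z, g z ∂((ℙ : Measure Ω').prod ℙ) =
      (∫ ω', rexp (α * ∫ s in Set.Ioc ε T, v (W s ω'))) *
        ∫ ω', rexp (α * ∫ s in Set.Ioc ε T, v (W' s ω')) := by
    rw [← integral_prod_mul]
    simp only [hgdef, mul_add, Real.exp_add]
  rw [← hprod]
  refine hlim.congr' ?_
  filter_upwards [hΔ0, eventually_gt_atTop (2 * T)] with t h0 ht
  have ht0 : 0 < t := by linarith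
  have hm := (hX t ht0).hasMeasurableVersion ht0
  have hSm : AEMeasurable (fun ω => rexp (α * ((∫ s in Set.Ioc ε T, v (X t s ω)) +
        ∫ s in Set.Ioc (t - T) (t - ε), v (X t s ω)))) (ℙ : Measure Ω) := by
    refine (((hm.aemeasurable_setIntegral measurableSet_Ioc ?_ hv).add
      (hm.aemeasurable_setIntegral measurableSet_Ioc ?_ hv)).const_mul α).exp
    · exact fun s hs => ⟨by linarith [hs.1], by linarith [hs.2]⟩
    · exact fun s hs => ⟨by linarith [hs.1], by linarith [hs.2]⟩
  rw [integral_eq_lintegral_of_nonneg_ae (ae_of_all _ fun _ => Real.exp_nonneg _)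
      hSm.aestronglyMeasurable,
    integral_eq_lintegral_of_nonneg_ae
      (ae_of_all _ fun z => mul_nonneg (h0 z) (Real.exp_nonneg _))
      ((hΔm t).mul hgm).aestronglyMeasurable,
    key (G := fun p => ENNReal.ofReal (rexp (α * (p.1 + p.2)))) (by fun_prop) t ht]
  congr 1
  refine lintegral_congr fun z => ?_
  rw [ENNReal.ofReal_mul (h0 z)]
end

end

section

lemma integrable_of_lintegral_ofReal_le {Z : Type*} [MeasurableSpace Z] {μ : Measure Z} {f : Z → ℝ}
    (hf : AEMeasurable f μ) (h0 : ∀ z, 0 ≤ f z) {B : ENNReal} (hB : B ≠ ⊤)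
    (h : ∫⁻ z, ENNReal.ofReal (f z) ∂μ ≤ B) : Integrable f μ ∧ ∫ z, f z ∂μ ≤ B.toReal := by
  refine ⟨⟨hf.aestronglyMeasurable, ?_⟩, ?_⟩
  · rw [hasFiniteIntegral_iff_ofReal (ae_of_all _ h0)]
    exact h.trans_lt hB.lt_top
  · rw [integral_eq_lintegral_of_nonneg_ae (ae_of_all _ h0) hf.aestronglyMeasurable]
    exact ENNReal.toReal_mono hB h

lemma setIntegral_Ioc_eq_add {f : ℝ → ℝ} {ε T t : ℝ} (hε : 0 ≤ ε) (hεT : ε ≤ T) (hT : T ≤ t - T)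
    (hf : IntegrableOn f (Set.Ioc 0 t)) :
    ∫ s in Set.Ioc 0 t, f s = (∫ s in Set.Ioc 0 ε, f s) + (∫ s in Set.Ioc ε T, f s) +
      (∫ s in Set.Ioc T (t - T), f s) + (∫ s in Set.Ioc (t - T) (t - ε), f s) +
      ∫ s in Set.Ioc (t - ε) t, f s := by
  have hint : IntervalIntegrable f volume 0 t :=
    (intervalIntegrable_iff_integrableOn_Ioc_of_le (by linarith)).2 hf
  have hI : ∀ {u w : ℝ}, 0 ≤ u → u ≤ t → 0 ≤ w → w ≤ t → IntervalIntegrable f volume u w :=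
    fun h1 h2 h3 h4 => hint.mono_set (by
      rw [Set.uIcc_of_le (show (0 : ℝ) ≤ t by linarith)]
      exact Set.uIcc_subset_Icc ⟨h1, h2⟩ ⟨h3, h4⟩)
  rw [← intervalIntegral.integral_of_le (by linarith), ← intervalIntegral.integral_of_le hε,
    ← intervalIntegral.integral_of_le hεT, ← intervalIntegral.integral_of_le hT,
    ← intervalIntegral.integral_of_le (by linarith),
    ← intervalIntegral.integral_of_le (by linarith),
    intervalIntegral.integral_add_adjacent_intervals,
    intervalIntegral.integral_add_adjacent_intervals,
    intervalIntegral.integral_add_adjacent_intervals,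
    intervalIntegral.integral_add_adjacent_intervals] <;>
  exact hI (by linarith) (by linarith) (by linarith) (by linarith)

lemma abs_setIntegral_outer_le {f : ℝ → ℝ} {ε T t : ℝ} (hε : 0 ≤ ε) (hεT : ε ≤ T)
    (hT : T ≤ t - T) (hf : IntegrableOn f (Set.Ioc 0 t)) :
    |(∫ s in Set.Ioc ε T, f s) + ∫ s in Set.Ioc (t - T) (t - ε), f s| ≤
      ∫ s in Set.Ioc 0 t, |f s| := by
  have h := setIntegral_Ioc_eq_add hε hεT hT hf.abs
  have h0 : ∀ u w : ℝ, 0 ≤ ∫ s in Set.Ioc u w, |f s| := fun u w =>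
    integral_nonneg fun _ => abs_nonneg _
  have h1 : ∀ u w : ℝ, |∫ s in Set.Ioc u w, f s| ≤ ∫ s in Set.Ioc u w, |f s| := fun u w =>
    abs_integral_le_integral_abs
  have h2 := abs_add_le (∫ s in Set.Ioc ε T, f s) (∫ s in Set.Ioc (t - T) (t - ε), f s)
  linarith [h1 ε T, h1 (t - T) (t - ε), h0 0 ε, h0 T (t - T), h0 (t - ε) t]

lemma abs_setIntegral_sub_outer_le {f : ℝ → ℝ} {C ε T t : ℝ} (hC : ∀ s, |f s| ≤ C) (hε : 0 ≤ ε)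
    (hεT : ε ≤ T) (hT : T ≤ t - T) (hf : IntegrableOn f (Set.Ioc 0 t)) :
    |(∫ s in Set.Ioc 0 t, f s) -
      ((∫ s in Set.Ioc ε T, f s) + ∫ s in Set.Ioc (t - T) (t - ε), f s)| ≤
      2 * C * ε + ∫ s in Set.Ioc T (t - T), |f s| := by
  have h1 := abs_le.1 (abs_setIntegral_Ioc_le hC hε)
  have h2 := abs_le.1 (abs_setIntegral_Ioc_le hC (show t - ε ≤ t by linarith))
  have h3 : |∫ s in Set.Ioc T (t - T), f s| ≤ ∫ s in Set.Ioc T (t - T), |f s| :=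
    abs_integral_le_integral_abs
  have h4 := abs_le.1 h3
  rw [setIntegral_Ioc_eq_add hε hεT hT hf, abs_le]
  constructor <;> linarith

lemma abs_exp_sub_exp_le {u w m : ℝ} (hu : u ≤ m) (hw : w ≤ m) :
    |rexp u - rexp w| ≤ rexp m * |u - w| := by
  wlog h : w ≤ u generalizing u w
  · rw [abs_sub_comm, abs_sub_comm u]
    exact this hw hu (le_of_not_ge h)
  rw [abs_of_nonneg (sub_nonneg.2 (Real.exp_le_exp.2 h)), abs_of_nonneg (sub_nonneg.2 h)]
  have h1 := Real.add_one_le_exp (w - u)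
  have h2 : rexp w = rexp u * rexp (w - u) := by rw [← Real.exp_add]; ring_nf
  have h3 : rexp u - rexp w ≤ rexp u * (u - w) := by
    rw [h2]; nlinarith [Real.exp_pos u]
  exact h3.trans (mul_le_mul_of_nonneg_right (Real.exp_le_exp.2 hu) (sub_nonneg.2 h))

lemma abs_exp_mul_sub_exp_mul_le {α β K z s V R : ℝ} (hβ : |α| ≤ β) (hz : |z| ≤ V) (hs : |s| ≤ V)
    (hR : |z - s| ≤ R) :
    |rexp (α * z) - rexp (α * s)| ≤
      |α| * rexp (|α| * K) * R + rexp (-(β - |α|) * K) * rexp (β * V) := by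
  have hle : ∀ {u : ℝ}, |u| ≤ V → α * u ≤ |α| * V := fun {u} h =>
    (le_abs_self _).trans (by rw [abs_mul]; gcongr)
  have hR0 : 0 ≤ R := (abs_nonneg _).trans hR
  have h2 : 0 ≤ |α| * rexp (|α| * K) * R := by positivity
  have h3 : 0 < rexp (-(β - |α|) * K) * rexp (β * V) := by positivity
  rcases le_total V K with hVK | hKV
  · have hm : |α| * V ≤ |α| * K := by gcongr
    have := abs_exp_sub_exp_le ((hle hz).trans hm) ((hle hs).trans hm)
    rw [← mul_sub, abs_mul] at this
    have h4 : rexp (|α| * K) * (|α| * |z - s|) ≤ rexp (|α| * K) * (|α| * R) := by gcongr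
    linarith
  · have h1 : ∀ {u : ℝ}, |u| ≤ V → rexp (α * u) ≤ rexp (-(β - |α|) * K) * rexp (β * V) := by
      intro u hu
      rw [← Real.exp_add, Real.exp_le_exp]
      nlinarith [hle hu]
    have := h1 hz
    have := h1 hs
    rw [abs_le]
    constructor <;> linarith [Real.exp_pos (α * z), Real.exp_pos (α * s)]

lemma tendsto_setIntegral_Ioc_inv {f : ℝ → ℝ} (hf : IntegrableOn f (Set.Ioi 0)) :
    Tendsto (fun T : ℝ => ∫ s in Set.Ioc T⁻¹ T, f s) atTop (𝓝 (∫ s in Set.Ioi 0, f s)) := by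
  have hcov : AECover (volume.restrict (Set.Ioi (0 : ℝ))) atTop fun T : ℝ => Set.Ioc T⁻¹ T := by
    refine ⟨?_, fun _ => measurableSet_Ioc⟩
    filter_upwards [ae_restrict_mem measurableSet_Ioi] with s hs
    filter_upwards [tendsto_inv_atTop_zero.eventually (gt_mem_nhds hs), eventually_ge_atTop s]
      with T h1 h2
    exact ⟨h1, h2⟩
  refine (hcov.integral_tendsto_of_countably_generated hf).congr' ?_
  filter_upwards [eventually_gt_atTop 0] with T hT
  rw [Measure.restrict_restrict measurableSet_Ioc, Set.inter_eq_left.2]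
  exact fun s hs => (inv_pos.2 hT).trans hs.1

section
variable {d : ℕ} {Ω Ω' : Type*} [MeasureSpace Ω] [MeasureSpace Ω']

lemma tendsto_gapBound (k : ℝ) {xf yf : ℝ → Euc d} {x y : Euc d}
    (hx : Tendsto xf atTop (𝓝 x)) (hy : Tendsto yf atTop (𝓝 y)) :
    Tendsto (fun t => gapBound d k x y (xf t) (yf t)) atTop (𝓝 (gapBound d k x y x y)) := by
  have h : Continuous fun p : Euc d × Euc d => gapBound d k x y p.1 p.2 := by
    unfold gapBound; fun_prop
  have h' := (h.tendsto (x, y)).comp (hx.prodMk_nhds hy)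
  exact h'

/-- Uniform exponential integrability of the path integrals of long bridges. -/
lemma exists_bridge_exp_bound [IsProbabilityMeasure (ℙ : Measure Ω)]
    [IsProbabilityMeasure (ℙ : Measure Ω')] (hd : 3 ≤ d) {v : Euc d → ℝ} (hv : Measurable v)
    {C : ℝ} (hC : ∀ z, |v z| ≤ C) (hL : ∫⁻ z, ‖v z‖ₑ ≠ ⊤) {β β' : ℝ} (hβ : 0 < β)
    (hβ' : β' < β) {xf yf : ℝ → Euc d} {x y : Euc d}
    (hx : Tendsto xf atTop (𝓝 x)) (hy : Tendsto yf atTop (𝓝 y))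
    {X : ℝ → ℝ → Ω → Euc d} (hX : ∀ t : ℝ, 0 < t → IsBrownianBridge t (xf t) (yf t) (X t))
    {W W' : ℝ → Ω' → Euc d} (hW : IsBrownianMotion x W) (hW' : IsBrownianMotion y W')
    (hM : totalMgf v W β ≠ ⊤) (hM' : totalMgf v W' β ≠ ⊤) :
    ∃ B : ℝ, ∀ᶠ t in atTop,
      Integrable (fun ω => rexp (β' * ∫ s in Set.Ioc 0 t, |v (X t s ω)|)) (ℙ : Measure Ω) ∧
      ∫ ω, rexp (β' * ∫ s in Set.Ioc 0 t, |v (X t s ω)|) ≤ B := by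
  obtain ⟨m, hm⟩ := exists_nat_one_div_lt (show 0 < 1 - β' / β by
    rw [sub_pos, div_lt_one hβ]; exact hβ')
  set n := m + 1 with hn
  have hβn : β' ≤ β * (1 - 1 / (n : ℝ)) := by
    rw [hn]; push_cast
    rw [← div_le_iff₀' hβ]
    linarith
  set g₀ := gapBound d ((n : ℝ) + 2) x y x y
  set B : ENNReal := n * (ENNReal.ofReal (rexp (β * (2 * C))) *
        (ENNReal.ofReal (g₀ + 1) * (totalMgf v W β * totalMgf v W' β))) with hB
  have hBtop : B ≠ ⊤ := by
    rw [hB]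
    exact ENNReal.mul_ne_top (by simp) (ENNReal.mul_ne_top (by simp)
      (ENNReal.mul_ne_top (by simp) (ENNReal.mul_ne_top hM hM')))
  refine ⟨B.toReal, ?_⟩
  filter_upwards [eventually_gt_atTop ((n : ℝ) + 2),
    (tendsto_gapBound ((n : ℝ) + 2) hx hy).eventually (gt_mem_nhds (lt_add_one g₀))] with t ht hg
  have ht0 : 0 < t := by have : (0 : ℝ) ≤ n := n.cast_nonneg; linarith
  have hXt := hX t ht0
  have hmeas : AEMeasurable (fun ω => rexp (β' * ∫ s in Set.Ioc 0 t, |v (X t s ω)|))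
      (ℙ : Measure Ω) :=
    (((hXt.hasMeasurableVersion ht0).aemeasurable_setIntegral measurableSet_Ioc
      Set.Ioc_subset_Icc_self hv.abs).const_mul β').exp
  refine integrable_of_lintegral_ofReal_le hmeas (fun _ => Real.exp_nonneg _) hBtop ?_
  refine (hXt.lintegral_exp_le hd hv hC hL hβ.le m.succ_pos hβn ht hW hW').trans ?_
  rw [hB]
  gcongr

/-- The middle part of a long bridge contributes little to the path integral. -/
lemma exists_bridge_middle_bound [IsProbabilityMeasure (ℙ : Measure Ω)] (hd : 3 ≤ d)
    {v : Euc d → ℝ} (hv : Measurable v) {C : ℝ} (hC : ∀ z, |v z| ≤ C) (hL : ∫⁻ z, ‖v z‖ₑ ≠ ⊤)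
    {xf yf : ℝ → Euc d} {x y : Euc d}
    (hx : Tendsto xf atTop (𝓝 x)) (hy : Tendsto yf atTop (𝓝 y))
    {X : ℝ → ℝ → Ω → Euc d} (hX : ∀ t : ℝ, 0 < t → IsBrownianBridge t (xf t) (yf t) (X t)) :
    ∃ δ : ℝ → ℝ, Tendsto δ atTop (𝓝 0) ∧ ∀ T, 0 < T → ∀ᶠ t in atTop,
      Integrable (fun ω => ∫ s in Set.Ioc T (t - T), |v (X t s ω)|) (ℙ : Measure Ω) ∧
      ∫ ω, ∫ s in Set.Ioc T (t - T), |v (X t s ω)| ≤ δ T := by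
  have hr : -(d : ℝ) / 2 < -1 := by
    have : (3 : ℝ) ≤ d := by exact_mod_cast hd
    linarith
  set A : ENNReal := ENNReal.ofReal (2 ^ ((d : ℝ) / 2) * 2) * ∫⁻ z, ‖v z‖ₑ with hA
  have hAtop : A ≠ ⊤ := ENNReal.mul_ne_top ENNReal.ofReal_ne_top hL
  set δ : ℝ → ENNReal := fun T => A * (2 * ∫⁻ s in Set.Ici T, ENNReal.ofReal (s ^ (-(d : ℝ) / 2)))
    with hδ
  have hlim : Tendsto δ atTop (𝓝 0) := by
    have h := ENNReal.Tendsto.const_mul (a := 2) (tendsto_lintegral_Ici_rpow hr)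
      (Or.inr ENNReal.ofNat_ne_top)
    have h' := ENNReal.Tendsto.const_mul (a := A) h (Or.inr hAtop)
    simpa using h'
  refine ⟨fun T => (δ T).toReal, ?_, fun T hT => ?_⟩
  · have h := (ENNReal.tendsto_toReal ENNReal.zero_ne_top).comp hlim
    rw [ENNReal.toReal_zero] at h
    exact h
  have hδtop : δ T ≠ ⊤ := by
    refine ENNReal.mul_ne_top hAtop (ENNReal.mul_ne_top ENNReal.ofNat_ne_top ?_)
    rw [lintegral_Ici_rpow hr hT]
    exact ENNReal.ofReal_ne_top
  have he : Tendsto (fun t : ℝ => rexp (‖yf t - xf t‖ ^ 2 / (2 * t))) atTop (𝓝 1) := by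
    have h : Tendsto (fun t : ℝ => 2 * t) atTop atTop := tendsto_id.const_mul_atTop two_pos
    simpa using (((hy.sub hx).norm.pow 2).div_atTop h).rexp
  filter_upwards [eventually_gt_atTop 0, he.eventually (gt_mem_nhds one_lt_two)] with t ht het
  have hXt := hX t ht
  have hsub : Set.Ioc T (t - T) ⊆ Set.Ioc 0 t := fun s hs =>
    ⟨hT.trans hs.1, by linarith [hs.2]⟩
  refine integrable_of_lintegral_ofReal_le
    ((hXt.hasMeasurableVersion ht).aemeasurable_setIntegral measurableSet_Ioc
      (hsub.trans Set.Ioc_subset_Icc_self) hv.abs)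
    (fun _ => integral_nonneg fun _ => abs_nonneg _) hδtop ?_
  have h1 : ∀ ω, ENNReal.ofReal (∫ s in Set.Ioc T (t - T), |v (X t s ω)|) =
      ∫⁻ s in Set.Ioc T (t - T), ‖v (X t s ω)‖ₑ := fun ω =>
    ofReal_integral_norm_eq_lintegral_enorm ((hXt.integrableOn_comp hv hC ω).mono_set hsub)
  simp only [h1]
  refine (hXt.lintegral_middle_le ht hv hT).trans ?_
  simp only [hδ, hA]
  gcongr

lemma IsBrownianMotion.tendsto_integral_exp [IsProbabilityMeasure (ℙ : Measure Ω')] (hd : 3 ≤ d)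
    {v : Euc d → ℝ} (hv : Measurable v) {C : ℝ} (hC : ∀ z, |v z| ≤ C) (hL : ∫⁻ z, ‖v z‖ₑ ≠ ⊤)
    {α : ℝ} {x : Euc d} {W : ℝ → Ω' → Euc d} (hW : IsBrownianMotion x W)
    (hM : totalMgf v W |α| ≠ ⊤) :
    Tendsto (fun T : ℝ => ∫ ω', rexp (α * ∫ s in Set.Ioc T⁻¹ T, v (W s ω'))) atTop
      (𝓝 (∫ ω', rexp (α * pathIntInf v W ω'))) := by
  have hm := hW.hasMeasurableVersion
  have hint := hW.ae_integrableOn hd hv hC hL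
  have hbd : Integrable (fun ω' => rexp (|α| * ∫ s in Set.Ioi (0 : ℝ), |v (W s ω')|))
      (ℙ : Measure Ω') :=
    (integrable_of_lintegral_ofReal_le
      ((hm.aemeasurable_setIntegral measurableSet_Ioi Set.Ioi_subset_Ici_self hv.abs).const_mul
        |α|).exp (fun _ => Real.exp_nonneg _) hM le_rfl).1
  refine tendsto_integral_filter_of_dominated_convergence _ ?_ ?_ hbd ?_
  · filter_upwards [eventually_gt_atTop 0] with T hT
    exact ((hm.aemeasurable_setIntegral measurableSet_Ioc
      (fun s hs => ((inv_pos.2 hT).trans hs.1).le) hv).const_mul α).exp.aestronglyMeasurable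
  · filter_upwards [eventually_gt_atTop 0] with T hT
    filter_upwards [hint] with ω' h
    rw [Real.norm_eq_abs, abs_of_pos (Real.exp_pos _), Real.exp_le_exp]
    refine (le_abs_self _).trans ?_
    rw [abs_mul]
    gcongr
    refine abs_integral_le_integral_abs.trans ?_
    refine setIntegral_mono_set h.abs (ae_of_all _ fun s => abs_nonneg _) ?_
    exact LE.le.eventuallyLE fun s hs => (inv_pos.2 hT).trans hs.1
  · filter_upwards [hint] with ω' h
    exact ((tendsto_setIntegral_Ioc_inv h).const_mul α).rexp

lemma lintegral_enorm_ne_top {v : Euc d → ℝ} {C R : ℝ} (hC : ∀ z, |v z| ≤ C)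
    (hR : ∀ z, v z ≠ 0 → ‖z‖ ≤ R) : ∫⁻ z, ‖v z‖ₑ ≠ ⊤ := by
  have h : ∀ z, ‖v z‖ₑ ≤
      (Metric.closedBall (0 : Euc d) R).indicator (fun _ => ENNReal.ofReal C) z := by
    intro z
    by_cases hz : v z = 0
    · simp [hz]
    · rw [Set.indicator_of_mem (by simpa using hR z hz), ← ofReal_norm]
      exact ENNReal.ofReal_le_ofReal (hC z)
  refine ((lintegral_mono h).trans_lt ?_).ne
  rw [lintegral_indicator measurableSet_closedBall, setLIntegral_const]
  exact ENNReal.mul_lt_top ENNReal.ofReal_lt_top measure_closedBall_lt_top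
end

end

/-- Theorem 1 (m.g.f.s): `E[e^{αZ(t)}] → E[e^{αY_x}] E[e^{αY_y}]` for `|α| < α₀`. -/
theorem stmt14 (d : ℕ) (hd : 3 ≤ d) (v : Euc d → ℝ)
    (hvm : Measurable v) (hvb : ∃ C : ℝ, ∀ z, |v z| ≤ C)
    (hvs : ∃ R : ℝ, ∀ z, v z ≠ 0 → ‖z‖ ≤ R)
    {Ω' : Type*} [MeasureSpace Ω'] [IsProbabilityMeasure (ℙ : Measure Ω')]
    (W : Euc d → ℝ → Ω' → Euc d) (hW : ∀ a, IsBrownianMotion a (W a))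
    (α₀ : ℝ) (hα₀ : 0 < α₀)
    (hexp : ∀ (a : Euc d) (α : ℝ), |α| < α₀ →
      (∫⁻ ω', ENNReal.ofReal (Real.exp (α * ∫ s in Set.Ioi (0 : ℝ), |v (W a s ω')|))) ≠ ⊤)
    (xf yf : ℝ → Euc d) (x y : Euc d)
    (hx : Tendsto xf atTop (𝓝 x)) (hy : Tendsto yf atTop (𝓝 y))
    {Ω : Type*} [MeasureSpace Ω] [IsProbabilityMeasure (ℙ : Measure Ω)]
    (X : ℝ → ℝ → Ω → Euc d) (hX : ∀ t : ℝ, 0 < t → IsBrownianBridge t (xf t) (yf t) (X t)) :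
    ∀ α : ℝ, |α| < α₀ →
      Tendsto (fun t : ℝ => ∫ ω, Real.exp (α * pathInt v (X t) t ω)) atTop
        (𝓝 ((∫ ω', Real.exp (α * pathIntInf v (W x) ω')) *
            (∫ ω', Real.exp (α * pathIntInf v (W y) ω')))) := by
  intro α hα
  obtain ⟨C, hC⟩ := hvb
  obtain ⟨R, hR⟩ := hvs
  have hC0 : 0 ≤ C := (abs_nonneg _).trans (hC 0)
  have hL := lintegral_enorm_ne_top hC hR
  obtain ⟨β, hαβ, hβ⟩ := exists_between hα
  obtain ⟨β₁, hββ₁, hβ₁⟩ := exists_between hβ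
  have hβ0 : 0 ≤ β := (abs_nonneg α).trans hαβ.le
  have hβ₁0 : 0 < β₁ := hβ0.trans_lt hββ₁
  have hM : ∀ a γ, 0 ≤ γ → γ < α₀ → totalMgf v (W a) γ ≠ ⊤ := fun a γ h0 h =>
    hexp a γ (by rwa [abs_of_nonneg h0])
  obtain ⟨B, hB⟩ := exists_bridge_exp_bound hd hvm hC hL hβ₁0 hββ₁ hx hy hX (hW x) (hW y)
    (hM x β₁ hβ₁0.le hβ₁) (hM y β₁ hβ₁0.le hβ₁)
  obtain ⟨δ, hδ0, hδ⟩ := exists_bridge_middle_bound hd hvm hC hL hx hy hX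
  have hlim := ((hW x).tendsto_integral_exp hd hvm hC hL (hM x _ (abs_nonneg α) hα)).mul
    ((hW y).tendsto_integral_exp hd hvm hC hL (hM y _ (abs_nonneg α) hα))
  set L := (∫ ω', Real.exp (α * pathIntInf v (W x) ω')) *
    (∫ ω', Real.exp (α * pathIntInf v (W y) ω'))
  rw [Metric.tendsto_nhds]
  intro η hη
  have hK : Tendsto (fun K : ℝ => rexp (-(β - |α|) * K) * B) atTop (𝓝 0) := by
    have h1 : Tendsto (fun K : ℝ => -(β - |α|) * K) atTop atBot :=
      tendsto_id.const_mul_atTop_of_neg (by linarith)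
    simpa using (Real.tendsto_exp_atBot.comp h1).mul_const B
  obtain ⟨K, hK⟩ := (hK.eventually (gt_mem_nhds (show 0 < η / 4 by positivity))).exists
  have hT : Tendsto (fun T : ℝ => |α| * rexp (|α| * K) * (2 * C * T⁻¹ + δ T)) atTop (𝓝 0) := by
    simpa using ((tendsto_inv_atTop_zero.const_mul (2 * C)).add hδ0).const_mul
      (|α| * rexp (|α| * K))
  obtain ⟨T, hT1, hT2, hT3⟩ := ((eventually_gt_atTop (1 : ℝ)).and
    ((hT.eventually (gt_mem_nhds (show 0 < η / 4 by positivity))).and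
      ((Metric.tendsto_nhds.1 hlim) (η / 4) (by positivity)))).exists
  have hT0 : 0 < T := by linarith
  have hTinv : 0 < T⁻¹ := inv_pos.2 hT0
  have hTT : T⁻¹ < T := (inv_lt_one_of_one_lt₀ hT1).trans hT1
  have houter := IsBrownianBridge.tendsto_integral_exp_outer hvm hC α hTinv hTT hx hy hX
    (hW x) (hW y)
  filter_upwards [Metric.tendsto_nhds.1 houter (η / 4) (by positivity), hB, hδ T hT0,
    eventually_gt_atTop (2 * T)] with t h1 ⟨hBi, hBle⟩ ⟨hδi, hδle⟩ ht
  have ht0 : 0 < t := by linarith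
  have hXt := hX t ht0
  have hm := hXt.hasMeasurableVersion ht0
  have hint := fun ω => hXt.integrableOn_comp hvm hC ω
  set V : Ω → ℝ := fun ω => ∫ s in Set.Ioc 0 t, |v (X t s ω)| with hV
  set S : Ω → ℝ := fun ω => (∫ s in Set.Ioc T⁻¹ T, v (X t s ω)) +
    ∫ s in Set.Ioc (t - T) (t - T⁻¹), v (X t s ω) with hS
  set Q : Ω → ℝ := fun ω => ∫ s in Set.Ioc T (t - T), |v (X t s ω)| with hQ
  have hZV : ∀ ω, |pathInt v (X t) t ω| ≤ V ω := fun ω => abs_integral_le_integral_abs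
  have hSV : ∀ ω, |S ω| ≤ V ω := fun ω =>
    abs_setIntegral_outer_le hTinv.le hTT.le (by linarith) (hint ω)
  have hZS : ∀ ω, |pathInt v (X t) t ω - S ω| ≤ 2 * C * T⁻¹ + Q ω := fun ω =>
    abs_setIntegral_sub_outer_le (fun s => hC _) hTinv.le hTT.le (by linarith) (hint ω)
  have hZm : AEMeasurable (fun ω => rexp (α * pathInt v (X t) t ω)) (ℙ : Measure Ω) :=
    ((hm.aemeasurable_setIntegral measurableSet_Ioc Set.Ioc_subset_Icc_self hvm).const_mul α).exp
  have hSm : AEMeasurable (fun ω => rexp (α * S ω)) (ℙ : Measure Ω) := by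
    refine (((hm.aemeasurable_setIntegral measurableSet_Ioc ?_ hvm).add
      (hm.aemeasurable_setIntegral measurableSet_Ioc ?_ hvm)).const_mul α).exp
    · exact fun s hs => ⟨by linarith [hs.1], by linarith [hs.2]⟩
    · exact fun s hs => ⟨by linarith [hs.1], by linarith [hs.2]⟩
  have hexpV : ∀ {f : Ω → ℝ}, AEMeasurable (fun ω => rexp (α * f ω)) (ℙ : Measure Ω) →
      (∀ ω, |f ω| ≤ V ω) → Integrable (fun ω => rexp (α * f ω)) (ℙ : Measure Ω) := by
    intro f hf hfV
    refine hBi.mono' hf.aestronglyMeasurable (ae_of_all _ fun ω => ?_)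
    rw [Real.norm_eq_abs, abs_of_pos (Real.exp_pos _), Real.exp_le_exp]
    refine (le_abs_self _).trans ?_
    rw [abs_mul]
    exact mul_le_mul hαβ.le (hfV ω) (abs_nonneg _) hβ0
  have hZi := hexpV hZm hZV
  have hSi := hexpV hSm hSV
  have hQi : Integrable (fun ω => 2 * C * T⁻¹ + Q ω) (ℙ : Measure Ω) :=
    (integrable_const _).add hδi
  have hdiff : |(∫ ω, rexp (α * pathInt v (X t) t ω)) - ∫ ω, rexp (α * S ω)| ≤
      |α| * rexp (|α| * K) * (2 * C * T⁻¹ + δ T) + rexp (-(β - |α|) * K) * B := by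
    rw [← integral_sub hZi hSi]
    have hle : ‖∫ ω, (rexp (α * pathInt v (X t) t ω) - rexp (α * S ω))‖ ≤
        ∫ ω, (|α| * rexp (|α| * K) * (2 * C * T⁻¹ + Q ω) +
          rexp (-(β - |α|) * K) * rexp (β * V ω)) :=
      norm_integral_le_of_norm_le ((hQi.const_mul _).add (hBi.const_mul _))
        (ae_of_all _ fun ω => abs_exp_mul_sub_exp_mul_le hαβ.le (hZV ω) (hSV ω) (hZS ω))
    refine hle.trans ?_
    rw [integral_add (hQi.const_mul _) (hBi.const_mul _), integral_const_mul, integral_const_mul,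
      integral_add (integrable_const _) hδi]
    simp only [integral_const, probReal_univ, one_smul]
    gcongr
  rw [Real.dist_eq] at h1 hT3 ⊢
  have h5 := abs_lt.1 h1
  have h6 := abs_lt.1 hT3
  have h7 := abs_le.1 hdiff
  rw [abs_lt]
  constructor <;> linarith
end
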